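/- arXiv:2003.12242 — 2 statements merged into one kernel-verified Lean document; each statement's English description precedes it below -/
import Mathlib

section
/- Let N > 0 and d > 0 be integers with W_d(N) ≠ ∅. Then the modest composition (the lexicographically largest element of W_d(N)) is the unique optimal composition: its weight is strictly smaller than the weight of every other element of W_d(N). -/
open Polynomial

/-- The power sum `S_d(-k) = ∑_{a monic, deg a = d} a^k`, written as a sum over the
lower-order coefficients of the monic polynomial. -/
noncomputable def powerSum (Fq : Type) [Field Fq] [Fintype Fq] (d k : ℕ) : Polynomial Fq :=
  ∑ c : Fin d → Fq, (X ^ d + ∑ i : Fin d, C (c i) * X ^ (i : ℕ)) ^ k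

/-- `m` sums to `k` with no carrying of digits in base `p`. -/
def NoCarry (p : ℕ) {n : ℕ} (m : Fin n → ℕ) (k : ℕ) : Prop :=
  (∑ i, m i) = k ∧ ∀ j : ℕ, (∑ i, m i / p ^ j % p) = k / p ^ j % p

/-- The set `U_d(k)`. -/
def Uset (p q d k : ℕ) : Set (Fin (d + 1) → ℕ) :=
  {m | NoCarry p m k ∧ ∀ i : Fin (d + 1), 0 < (i : ℕ) → 0 < m i ∧ (q - 1) ∣ m i}

/-- The weight of an element of `U_d(k)`. -/
def wtU {d : ℕ} (m : Fin (d + 1) → ℕ) : ℕ :=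
  ∑ i : Fin (d + 1), (d - (i : ℕ)) * m i

/-- Strict lexicographic order on tuples. -/
def LexLT {n : ℕ} (x y : Fin n → ℕ) : Prop :=
  ∃ i, (∀ j, j < i → x j = y j) ∧ x i < y i

/-- Lexicographic order on tuples. -/
def LexLE {n : ℕ} (x y : Fin n → ℕ) : Prop := x = y ∨ LexLT x y

/-- `L_k := min_{0 ≤ i < f} l(k p^i)/(q-1)` where `l` is the base-`q` digit sum, `q = p^f`. -/
noncomputable def Lval (p f k : ℕ) (hf : 0 < f) : ℚ :=
  (Finset.range f).inf' ⟨0, Finset.mem_range.mpr hf⟩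
    (fun i => ((Nat.digits (p ^ f) (k * p ^ i)).sum : ℚ) / ((p : ℚ) ^ f - 1))

/-- The set `W_d(N)` of compositions. -/
def Wset (p q d N : ℕ) : Set (Fin d → ℕ) :=
  {Y | NoCarry p Y N ∧ ∀ i : Fin d, (i : ℕ) + 1 < d → 0 < Y i ∧ (q - 1) ∣ Y i}

/-- The weight of a composition. -/
def wtW {d : ℕ} (Y : Fin d → ℕ) : ℕ := ∑ i : Fin d, ((i : ℕ) + 1) * Y i

/-- `X` is the modest (lexicographically largest) composition in `W_d(N)`. -/
def Modest (p q : ℕ) {d : ℕ} (N : ℕ) (X : Fin d → ℕ) : Prop :=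
  X ∈ Wset p q d N ∧ ∀ Y ∈ Wset p q d N, LexLE Y X

/-- `X` is an optimal (minimum weight) composition in `W_d(N)`. -/
def Optimal (p q : ℕ) {d : ℕ} (N : ℕ) (X : Fin d → ℕ) : Prop :=
  X ∈ Wset p q d N ∧ ∀ Y ∈ Wset p q d N, wtW X ≤ wtW Y

/-- `Γ(n) : Fin f → ℕ`, summing the base-`p` digits of `n` in each residue class mod `f`. -/
def Gamma (p f n : ℕ) : Fin f → ℕ :=
  fun i => ∑ j ∈ Finset.range (Nat.log p n + 1), if j % f = (i : ℕ) then n / p ^ j % p else 0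

/-- The cyclic matrix `E`, as a map: `(E x)_i = p x_{i+1} - x_i`, indices mod `f`. -/
def Emap (p : ℕ) {R : Type} [Ring R] {f : ℕ} (x : Fin f → R) : Fin f → R :=
  fun i => (p : R) * x ⟨((i : ℕ) + 1) % f, Nat.mod_lt _ i.pos⟩ - x i

/-- `𝔍 = {Γ(n) : n > 0 is q-even}`, where `q = p ^ f`. -/
def Jfrak (p f : ℕ) : Set (Fin f → ℕ) :=
  {w | ∃ n : ℕ, 0 < n ∧ (p ^ f - 1) ∣ n ∧ Gamma p f n = w}

/-- `I_d`. -/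
def Iset (p f d : ℕ) : Set (Fin f → ℕ) :=
  {u | (∃ n : ℕ, 0 < n ∧ Gamma p f n = u) ∧
    ∃ v : Fin (d - 1) → Fin f → ℕ, (∀ j, v j ∈ Jfrak p f) ∧ (∑ j, v j) < u}

/-- `J_d`. -/
def Jset (p f d : ℕ) : Set (Fin f → ℕ) :=
  if d = 0 then ∅ else Jfrak p f ∩ (Iset p f d \ Iset p f (d + 1))

/-- A composition is `τ`-monotonic. -/
def TauMonotonic (p f : ℕ) {d : ℕ} (X : Fin d → ℕ) : Prop :=
  ∀ i j : Fin d, i < j → ∀ m n : ℕ, X i / p ^ m % p ≠ 0 → X j / p ^ n % p ≠ 0 →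
    m % f = n % f → n ≤ m

/-- `W_d^B(N)`: compositions in `W_d(N)` whose `Γ`-matrix is `B`. -/
def WBset (p f d N : ℕ) (B : Fin d → Fin f → ℕ) : Set (Fin d → ℕ) :=
  {Y | Y ∈ Wset p (p ^ f) d N ∧ ∀ j, Gamma p f (Y j) = B j}

/-- The multizeta value `ζ(-k_1, …, -k_r)` as a (finite) sum over strictly
decreasing tuples of degrees. -/
noncomputable def multizeta (Fq : Type) [Field Fq] [Fintype Fq] {r : ℕ} (k : Fin r → ℕ) :
    Polynomial Fq :=
  ∑ᶠ (dt : Fin r → ℕ) (_ : StrictAnti dt), ∏ i, powerSum Fq (dt i) (k i)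

namespace Sheats

/-- The cyclic operator `(E x)_i = p x_{i+1} - x_i`. -/
def Eo {f : ℕ} (p : ℕ) (x : ZMod f → ℤ) : ZMod f → ℤ := fun i => (p : ℤ) * x (i + 1) - x i

/-- The unit vector. -/
def ev {f : ℕ} (i : ZMod f) : ZMod f → ℤ := fun l => if l = i then 1 else 0

/-- A bin with need vector `e` can still accept a unit of class `i`. -/
def Acc {f : ℕ} (p : ℕ) (s e : ZMod f → ℤ) (i : ZMod f) : Prop :=
  ∃ Y y : ZMod f → ℤ, 0 ≤ y ∧ y ≤ Y ∧ Eo p Y ≤ s ∧ ev i ≤ e + Eo p y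

section vec
variable {f p : ℕ}

lemma Eo_add (x y : ZMod f → ℤ) : Eo p (x + y) = Eo p x + Eo p y := by
  funext i; simp only [Eo, Pi.add_apply]; ring

lemma Eo_sub (x y : ZMod f → ℤ) : Eo p (x - y) = Eo p x - Eo p y := by
  funext i; simp only [Eo, Pi.sub_apply]; ring

lemma Eo_zero : Eo p (0 : ZMod f → ℤ) = 0 := by
  funext i; simp [Eo]

lemma Eo_sum {ι : Type*} (S : Finset ι) (Y : ι → ZMod f → ℤ) :
    Eo p (∑ j ∈ S, Y j) = ∑ j ∈ S, Eo p (Y j) := by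
  classical
  induction S using Finset.induction_on with
  | empty => simp [Eo_zero]
  | insert a S ha ih => rw [Finset.sum_insert ha, Finset.sum_insert ha, Eo_add, ih]

lemma Eo_sup {x y s : ZMod f → ℤ} (hx : Eo p x ≤ s) (hy : Eo p y ≤ s) : Eo p (x ⊔ y) ≤ s := by
  intro i
  have h1 := hx i
  have h2 := hy i
  simp only [Eo, Pi.sup_apply] at *
  rcases le_total (x (i+1)) (y (i+1)) with h | h
  · rw [sup_eq_right.mpr h]
    have := le_sup_right (a := x i) (b := y i)
    linarith
  · rw [sup_eq_left.mpr h]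
    have := le_sup_left (a := x i) (b := y i)
    linarith

lemma exists_least (hp : 2 ≤ p) (e : ZMod f → ℤ) (he : 0 ≤ e) (i : ZMod f) :
    ∃ χ : ZMod f → ℤ, 0 ≤ χ ∧ χ ≤ 1 ∧ ev i ≤ e + Eo p χ ∧
      ∀ y, 0 ≤ y → ev i ≤ e + Eo p y → χ ≤ y := by
  classical
  refine ⟨fun l => if (∀ y : ZMod f → ℤ, 0 ≤ y → ev i ≤ e + Eo p y → 1 ≤ y l) then 1 else 0,
    ?_, ?_, ?_, ?_⟩
  · intro l; dsimp; split_ifs <;> simp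
  · intro l; dsimp; split_ifs <;> simp
  · intro x
    have hpz : (2 : ℤ) ≤ p := by exact_mod_cast hp
    have hex := he x
    simp only [Pi.add_apply, Eo, ev, Pi.zero_apply] at *
    by_cases h1 : (∀ y : ZMod f → ℤ, 0 ≤ y → ev i ≤ e + Eo p y → 1 ≤ y (x+1))
    · rw [if_pos h1]
      split_ifs <;> linarith
    · have h1' := h1
      rw [if_neg h1']
      push Not at h1
      obtain ⟨y, hy0, hy, hy1⟩ := h1
      have a1 := hy0 (x+1)
      have a2 := hy0 x
      have a3 := hy x
      simp only [Pi.add_apply, Eo, ev, Pi.zero_apply] at *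
      have : y (x+1) = 0 := by omega
      rw [this] at a3
      by_cases h2 : (∀ y : ZMod f → ℤ, 0 ≤ y → ev i ≤ e + Eo p y → 1 ≤ y x)
      · have := h2 y hy0 hy
        rw [if_pos h2]
        split_ifs at * <;> linarith
      · rw [if_neg h2]
        split_ifs at * <;> linarith
  · intro y hy0 hy l
    dsimp
    split_ifs with h
    · exact h y hy0 hy
    · exact hy0 l

lemma exists_min_w [NeZero f] (hp : 2 ≤ p) (ν W n : ZMod f → ℤ) (hν0 : 0 ≤ ν) (hν1 : ν ≤ 1)
    (hW : ν ≤ W) (hn : 0 ≤ n) (hE : Eo p W ≤ n) :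
    ∃ w, ν ≤ w ∧ w ≤ W ∧ Eo p w ≤ n ∧
      ∀ l, Eo p w l < 0 → ν l = 1 ∧ w l = 1 ∧ w (l + 1) = 0 := by
  classical
  let Pr : ℕ → Prop := fun k => ∃ w, ν ≤ w ∧ w ≤ W ∧ Eo p w ≤ n ∧ ∑ l, w l = k
  have hex : ∃ k, Pr k := by
    refine ⟨(∑ l, W l).toNat, W, hW, le_rfl, hE, ?_⟩
    rw [Int.toNat_of_nonneg]
    exact Finset.sum_nonneg fun l _ => (hν0 l).trans (hW l)
  obtain ⟨w, h1, h2, h3, h4⟩ := Nat.find_spec hex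
  have hmin := fun k => Nat.find_min hex (m := k)
  refine ⟨w, h1, h2, h3, ?_⟩
  intro l hl
  have hwl : w l = ν l := by
    by_contra hne
    have hlt : ν l < w l := lt_of_le_of_ne (h1 l) (Ne.symm hne)
    have hw0 : 0 ≤ w l - 1 := by have := hν0 l; simp only [Pi.zero_apply] at this; omega
    have hS : ∑ x, (w - ev l) x = (∑ x, w x) - 1 := by
      simp [ev, Finset.sum_sub_distrib]
    have hnn : 0 ≤ ∑ x, (w - ev l) x := by
      apply Finset.sum_nonneg
      intro x _
      have := (hν0 x).trans (h1 x)
      simp only [Pi.sub_apply, ev, Pi.zero_apply] at *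
      split_ifs with hx
      · rw [hx]; exact hw0
      · linarith
    apply hmin (∑ x, (w - ev l) x).toNat
    · rw [h4] at hS; omega
    · refine ⟨w - ev l, ?_, ?_, ?_, ?_⟩
      · intro x
        have := h1 x
        simp only [Pi.sub_apply, ev]
        split_ifs with hx
        · rw [hx] at *; omega
        · linarith
      · intro x
        have := h2 x
        simp only [Pi.sub_apply, ev]
        split_ifs <;> linarith
      · intro x
        have a1 := h3 x
        have a2 := hn x
        simp only [Eo, Pi.sub_apply, ev, Pi.zero_apply] at *
        by_cases hx : x = l
        · subst hx
          rw [if_pos rfl]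
          split_ifs <;> nlinarith [Int.natCast_nonneg p]
        · rw [if_neg hx]
          split_ifs <;> nlinarith [Int.natCast_nonneg p]
      · rw [Int.toNat_of_nonneg hnn]
  have b1 := hν1 l
  have b2 := hν0 l
  have b3 := (hν0 (l+1)).trans (h1 (l+1))
  simp only [Eo, Pi.zero_apply, Pi.one_apply] at *
  have b4 : 0 ≤ (p : ℤ) * w (l+1) := by positivity
  have b5 : ν l = 1 := by omega
  refine ⟨b5, by omega, ?_⟩
  have b6 : (p : ℤ) * w (l+1) = 0 := by omega
  rcases mul_eq_zero.mp b6 with h | h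
  · exfalso; omega
  · exact h

lemma exists_split [NeZero f] (V e t : ZMod f → ℤ) (hV : 0 ≤ V) (he : 0 ≤ e) (ht : 0 ≤ t)
    (hE : Eo p V ≤ t - e) :
    ∃ y, 0 ≤ y ∧ y ≤ V ∧ 0 ≤ e + Eo p y ∧ e + Eo p y ≤ t := by
  classical
  let Pr : ℕ → Prop := fun k => ∃ y, 0 ≤ y ∧ y ≤ V ∧ 0 ≤ e + Eo p y ∧ ∑ l, (V l - y l) = k
  have hex : ∃ k, Pr k := by
    refine ⟨(∑ l, (V l - 0)).toNat, 0, le_rfl, hV, by rw [Eo_zero]; simpa using he, ?_⟩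
    rw [Int.toNat_of_nonneg]
    · simp
    · exact Finset.sum_nonneg fun l _ => by have := hV l; simpa using this
  obtain ⟨y, h1, h2, h3, h4⟩ := Nat.find_spec hex
  have hmin := fun k => Nat.find_min hex (m := k)
  refine ⟨y, h1, h2, h3, ?_⟩
  intro l
  have key : y l = V l ∨ (e + Eo p y) l = 0 := by
    by_contra hne
    push Not at hne
    have hlt : y l < V l := lt_of_le_of_ne (h2 l) hne.1
    have hlt2 : 0 < (e + Eo p y) l := lt_of_le_of_ne (h3 l) (Ne.symm hne.2)
    have hS : ∑ x, (V x - (y + ev l) x) = (∑ x, (V x - y x)) - 1 := by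
      simp [ev, Finset.sum_sub_distrib, Finset.sum_add_distrib]; ring
    have hle : y + ev l ≤ V := by
      intro x
      have := h2 x
      simp only [Pi.add_apply, ev]
      split_ifs with hx
      · rw [hx] at *; omega
      · linarith
    have hnn : 0 ≤ ∑ x, (V x - (y + ev l) x) :=
      Finset.sum_nonneg fun x _ => sub_nonneg.mpr (hle x)
    apply hmin (∑ x, (V x - (y + ev l) x)).toNat
    · rw [h4] at hS; omega
    · refine ⟨y + ev l, ?_, hle, ?_, ?_⟩
      · intro x
        have := h1 x
        simp only [Pi.add_apply, ev, Pi.zero_apply] at *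
        split_ifs <;> linarith
      · intro x
        have a1 := h3 x
        simp only [Eo, Pi.add_apply, ev, Pi.zero_apply] at *
        by_cases hx : x = l
        · subst hx
          rw [if_pos rfl]
          split_ifs <;> nlinarith [Int.natCast_nonneg p]
        · rw [if_neg hx]
          split_ifs <;> nlinarith [Int.natCast_nonneg p]
      · rw [Int.toNat_of_nonneg hnn]
  rcases key with h | h
  · have a1 := hE l
    have a2 := h2 (l+1)
    simp only [Eo, Pi.add_apply, Pi.sub_apply] at *
    rw [h]
    nlinarith [Int.natCast_nonneg p]
  · rw [h]; exact ht l

lemma Acc_pred (hp : 2 ≤ p) {s e : ZMod f → ℤ} (he : 0 ≤ e) {l : ZMod f} (h : Acc p s e l)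
    {Y1 : ZMod f → ℤ} (hY1 : Eo p Y1 ≤ s) (hl : 1 ≤ Y1 l) : Acc p s e (l - 1) := by
  classical
  obtain ⟨Y, y, hy0, hyY, hY, hy⟩ := h
  refine ⟨Y ⊔ Y1, fun x => if x = l then 1 else min (y x) 1, ?_, ?_, Eo_sup hY hY1, ?_⟩
  · intro x
    have := hy0 x
    simp only [Pi.zero_apply] at *
    split_ifs
    · norm_num
    · exact le_min this (by norm_num)
  · intro x
    have := hyY x
    simp only [Pi.sup_apply]
    split_ifs with hx
    · rw [hx]; exact hl.trans le_sup_right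
    · exact (min_le_left _ _).trans (this.trans le_sup_left)
  · intro x
    have hpz : (2 : ℤ) ≤ p := by exact_mod_cast hp
    have a1 := he x
    have a2 := hy x
    have a3 := hy0 x
    have a4 := hy0 (x+1)
    simp only [Pi.add_apply, Eo, ev, Pi.zero_apply] at *
    have c1 : (if x = l then (1:ℤ) else min (y x) 1) ≤ 1 := by
      split_ifs
      · exact le_rfl
      · exact min_le_right _ _
    by_cases hx : x + 1 = l
    · rw [if_pos (eq_sub_of_add_eq hx), if_pos hx]
      linarith
    · have hx' : ¬ x = l - 1 := fun h => hx (by rw [h]; ring)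
      rw [if_neg hx', if_neg hx]
      rcases le_or_gt 1 (y (x+1)) with h1 | h1
      · rw [min_eq_right h1]; linarith
      · have h0 : y (x+1) = 0 := by omega
        rw [h0] at a2 ⊢
        split_ifs at a2 ⊢
        · rw [show min (0:ℤ) 1 = 0 by norm_num, mul_zero]; rw [mul_zero] at a2; linarith
        · have := min_le_left (y x) 1
          rw [show min (0:ℤ) 1 = 0 by norm_num, mul_zero]; rw [mul_zero] at a2; linarith

lemma chi_zero (e χ : ZMod f → ℤ) (i : ZMod f) (h0 : 0 ≤ χ) (h1 : χ ≤ 1)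
    (hχ : ev i ≤ e + Eo p χ) (hmin : ∀ y, 0 ≤ y → ev i ≤ e + Eo p y → χ ≤ y)
    (S : ZMod f → Prop) (hS : ∀ x, S x → 1 ≤ χ x → S (x - 1)) (hi : ¬ S i)
    (he : ∀ x, S x → 1 ≤ e x) : ∀ x, S x → χ x = 0 ∧ χ (x + 1) = 0 := by
  classical
  have key : ∀ x, S (x - 1) → χ x = 0 := by
    have : χ ≤ fun x => if S (x - 1) then 0 else χ x := by
      apply hmin
      · intro x
        have := h0 x
        dsimp at *
        split_ifs
        · exact le_rfl
        · exact this
      · intro x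
        have a0 := h0 x
        have a1 := h1 x
        have a2 := hχ x
        simp only [Pi.add_apply, Eo, ev, Pi.zero_apply, Pi.one_apply, add_sub_cancel_right] at *
        by_cases hx : S x
        · have := he x hx
          have hne : ¬ x = i := fun h => hi (h ▸ hx)
          rw [if_pos hx, if_neg hne]
          split_ifs <;> linarith
        · rw [if_neg hx]
          have : (if S (x - 1) then 0 else χ x) ≤ χ x := by split_ifs <;> linarith
          linarith
    intro x hx
    have a := this x
    have b := h0 x
    simp only [if_pos hx, Pi.zero_apply] at a b
    omega
  intro x hx
  refine ⟨?_, key _ (by simpa using hx)⟩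
  by_contra hne
  have b := h0 x
  simp only [Pi.zero_apply] at b
  exact hne (key x (hS x hx (by omega)))

end vec
end Sheats

namespace Sheats
set_option linter.unusedSectionVars false

section units
variable {ι : Type*} [DecidableEq ι] {f : ℕ}

/-- Class-count vector of a finite set of units. -/
def vec (f : ℕ) (m : ι → ℕ) (Q : Finset ι) : ZMod f → ℤ := ∑ u ∈ Q, ev ((m u : ℕ) : ZMod f)

/-- Class-count vector of a bin. -/
def cnt (f : ℕ) (m : ι → ℕ) (R : Finset ι) (φ : ι → ℕ) (j : ℕ) : ZMod f → ℤ :=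
  vec f m (R.filter fun u => φ u = j)

/-- Content of a bin. -/
def Bs (p : ℕ) (m : ι → ℕ) (R : Finset ι) (φ : ι → ℕ) (j : ℕ) : ℕ :=
  ∑ u ∈ R, if φ u = j then p ^ m u else 0

/-- Weight of an assignment. -/
def wgt (p : ℕ) (m : ι → ℕ) (R : Finset ι) (φ : ι → ℕ) : ℕ :=
  ∑ u ∈ R, φ u * p ^ m u

/-- Lexicographically larger and of smaller weight. -/
def Better (p : ℕ) (m : ι → ℕ) (R : Finset ι) (φ φ' : ι → ℕ) : Prop :=
  (∃ b, (∀ j, j < b → Bs p m R φ' j = Bs p m R φ j) ∧ Bs p m R φ b < Bs p m R φ' b) ∧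
    wgt p m R φ' < wgt p m R φ

/-- Validity of an assignment with certificate `Y`. -/
def ValidY (p : ℕ) {f : ℕ} (m : ι → ℕ) (D : ℕ) (R : Finset ι) (e : ℕ → ZMod f → ℤ) (φ : ι → ℕ)
    (Y : ℕ → ZMod f → ℤ) : Prop :=
  (∀ u ∈ R, φ u ≤ D) ∧ ∀ j, j < D → 0 ≤ Y j ∧ cnt f m R φ j = e j + Eo p (Y j)

/-- Validity of an assignment. -/
def Valid (p : ℕ) {f : ℕ} (m : ι → ℕ) (D : ℕ) (R : Finset ι) (e : ℕ → ZMod f → ℤ)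
    (φ : ι → ℕ) : Prop := ∃ Y, ValidY p m D R e φ Y

/-- Not improvable. -/
def NI (p : ℕ) {f : ℕ} (m : ι → ℕ) (D : ℕ) (R : Finset ι) (e : ℕ → ZMod f → ℤ)
    (φ : ι → ℕ) : Prop := Valid p m D R e φ ∧ ∀ φ', Valid p m D R e φ' → ¬ Better p m R φ φ'

/-- Each exponent occurs less than `p` times. -/
def Mult (p : ℕ) (m : ι → ℕ) (R : Finset ι) : Prop :=
  ∀ a, (R.filter fun u => m u = a).card < p

/-- Total slack. -/
def slack {f : ℕ} (m : ι → ℕ) (D : ℕ) (R : Finset ι) (e : ℕ → ZMod f → ℤ) : ZMod f → ℤ :=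
  vec f m R - ∑ j ∈ Finset.range D, e j

/-- The invariant. -/
def Inv (p : ℕ) {f : ℕ} (m : ι → ℕ) (D : ℕ) (R : Finset ι) (e : ℕ → ZMod f → ℤ) : Prop :=
  (∀ j, j < D → 0 ≤ e j) ∧
    ∀ b b', b < b' → b' < D → ∀ l, Acc p (slack m D R e) (e b) l → 1 ≤ e b' l

variable {m : ι → ℕ} {R : Finset ι} {φ φ' : ι → ℕ} {p D : ℕ} {e Y : ℕ → ZMod f → ℤ}

lemma vec_apply (Q : Finset ι) (l : ZMod f) :
    vec f m Q l = ((Q.filter fun u => ((m u : ℕ) : ZMod f) = l).card : ℤ) := by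
  rw [vec, Finset.sum_apply, Finset.card_filter]
  push_cast
  refine Finset.sum_congr rfl fun u _ => ?_
  simp only [ev, eq_comm]

lemma vec_nonneg (Q : Finset ι) : 0 ≤ vec f m Q := by
  intro l; rw [vec_apply]; simp

lemma vec_mono {Q Q' : Finset ι} (h : Q ⊆ Q') : vec f m Q ≤ vec f m Q' := by
  intro l; rw [vec_apply, vec_apply]
  have := Finset.card_le_card (Finset.filter_subset_filter (fun u => ((m u : ℕ) : ZMod f) = l) h)
  exact Int.ofNat_le.mpr this

lemma cnt_nonneg (j : ℕ) : 0 ≤ cnt f m R φ j := vec_nonneg _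

lemma vec_union {Q Q' : Finset ι} (h : Disjoint Q Q') :
    vec f m (Q ∪ Q') = vec f m Q + vec f m Q' := Finset.sum_union h

lemma cnt_add {j k : ℕ} (hjk : j ≠ k) : cnt f m R φ j + cnt f m R φ k =
    vec f m (R.filter fun u => φ u = j ∨ φ u = k) := by
  rw [Finset.filter_or, vec_union]
  · rfl
  · rw [Finset.disjoint_filter]; intro u _ h1 h2; exact hjk (h1.symm.trans h2)

lemma exists_sub_vec {Q A : Finset ι} {T : ZMod f → ℤ} (hQ : Q ⊆ A) (h1 : vec f m Q ≤ T)
    (h2 : T ≤ vec f m A) : ∃ S, Q ⊆ S ∧ S ⊆ A ∧ vec f m S = T := by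
  have key : ∀ l : ZMod f, ∃ S, (Q.filter fun u => ((m u : ℕ) : ZMod f) = l) ⊆ S ∧
      S ⊆ (A.filter fun u => ((m u : ℕ) : ZMod f) = l) ∧ S.card = (T l).toNat := by
    intro l
    have a1 : vec f m Q l ≤ T l := h1 l
    have a2 : T l ≤ vec f m A l := h2 l
    rw [vec_apply] at a1 a2
    apply Finset.exists_subsuperset_card_eq
    · exact Finset.filter_subset_filter _ hQ
    · omega
    · omega
  choose S hS1 hS2 hS3 using key
  refine ⟨A.filter fun u => u ∈ S (m u), ?_, Finset.filter_subset _ _, ?_⟩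
  · intro u hu
    exact Finset.mem_filter.mpr ⟨hQ hu, hS1 _ (Finset.mem_filter.mpr ⟨hu, rfl⟩)⟩
  · funext l
    rw [vec_apply]
    have : ((A.filter fun u => u ∈ S (m u)).filter fun u => ((m u : ℕ) : ZMod f) = l) = S l := by
      ext u
      simp only [Finset.mem_filter]
      constructor
      · rintro ⟨⟨_, h⟩, rfl⟩; exact h
      · intro h
        have := Finset.mem_filter.mp (hS2 l h)
        exact ⟨⟨this.1, by rw [this.2]; exact h⟩, this.2⟩
    rw [this, hS3]
    have a1 : vec f m Q l ≤ T l := h1 l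
    have := vec_nonneg (m := m) Q l
    simp only [Pi.zero_apply] at this
    omega

lemma move {j k : ℕ} (hjk : j ≠ k) {Q : Finset ι} {T : ZMod f → ℤ}
    (hQ : Q ⊆ R.filter fun u => φ u = j ∨ φ u = k) (h1 : vec f m Q ≤ T)
    (h2 : T ≤ cnt f m R φ j + cnt f m R φ k) :
    ∃ φ' : ι → ℕ, (∀ u ∈ R, φ' u = φ u ∨ ((φ u = j ∨ φ u = k) ∧ (φ' u = j ∨ φ' u = k))) ∧
      (∀ u ∈ Q, φ' u = j) ∧ cnt f m R φ' j = T ∧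
      cnt f m R φ' k = cnt f m R φ j + cnt f m R φ k - T ∧
      ∀ b, b ≠ j → b ≠ k → cnt f m R φ' b = cnt f m R φ b := by
  rw [cnt_add hjk] at h2 ⊢
  obtain ⟨S, hS1, hS2, hS3⟩ := exists_sub_vec hQ h1 h2
  have hSm : ∀ u ∈ S, u ∈ R ∧ (φ u = j ∨ φ u = k) := fun u hu => Finset.mem_filter.mp (hS2 hu)
  let φ' : ι → ℕ := fun u => if φ u = j ∨ φ u = k then (if u ∈ S then j else k) else φ u
  have hj : cnt f m R φ' j = T := by
    rw [cnt, ← hS3]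
    congr 1
    ext u
    simp only [Finset.mem_filter, φ']
    constructor
    · rintro ⟨h, h'⟩
      split_ifs at h' with h3 h4
      · exact h4
      · exact absurd h'.symm hjk
      · exact absurd (Or.inl h') h3
    · intro h
      have := hSm u h
      exact ⟨this.1, by rw [if_pos this.2, if_pos h]⟩
  have hb : ∀ b, b ≠ j → b ≠ k → cnt f m R φ' b = cnt f m R φ b := by
    intro b hbj hbk
    rw [cnt, cnt]
    congr 1
    apply Finset.filter_congr
    intro u _
    simp only [φ']
    split_ifs with h3 h4
    · constructor
      · intro h; exact absurd h.symm hbj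
      · intro h; subst h; rcases h3 with h3 | h3 <;> simp_all
    · constructor
      · intro h; exact absurd h.symm hbk
      · intro h; subst h; rcases h3 with h3 | h3 <;> simp_all
    · rfl
  have hc : ∀ u ∈ R, φ' u = φ u ∨ ((φ u = j ∨ φ u = k) ∧ (φ' u = j ∨ φ' u = k)) := by
    intro u _
    simp only [φ']
    split_ifs with h3 h4
    · right; exact ⟨h3, Or.inl rfl⟩
    · right; exact ⟨h3, Or.inr rfl⟩
    · left; rfl
  refine ⟨φ', hc, ?_, hj, ?_, hb⟩
  · intro u hu
    have := hSm u (hS1 hu)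
    simp only [φ']
    rw [if_pos this.2, if_pos (hS1 hu)]
  · have h5 := cnt_add (f := f) (m := m) (R := R) (φ := φ') hjk
    have h6 : (R.filter fun u => φ' u = j ∨ φ' u = k) = R.filter fun u => φ u = j ∨ φ u = k := by
      apply Finset.filter_congr
      intro u hu
      rcases hc u hu with h | h
      · rw [h]
      · exact ⟨fun _ => h.1, fun _ => h.2⟩
    rw [h6, hj] at h5
    rw [← h5]; ring

lemma mult_sum (hm : Mult p m R) (M : ℕ) :
    ∑ u ∈ R, (if m u < M then p ^ m u else 0) < p ^ M := by
  induction M with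
  | zero => simp
  | succ M ih =>
    have h : ∀ u ∈ R, (if m u < M + 1 then p ^ m u else 0) =
        (if m u < M then p ^ m u else 0) + (if m u = M then p ^ M else 0) := by
      intro u _
      rcases lt_trichotomy (m u) M with h | h | h
      · rw [if_pos (by omega), if_pos h, if_neg (by omega), add_zero]
      · rw [if_pos (by omega), if_neg (by omega), if_pos h, h, zero_add]
      · rw [if_neg (by omega), if_neg (by omega), if_neg (by omega)]
    rw [Finset.sum_congr rfl h, Finset.sum_add_distrib]
    rw [← Finset.sum_filter (fun u => m u = M), Finset.sum_const, smul_eq_mul]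
    have h3 : (R.filter fun u => m u = M).card + 1 ≤ p := hm M
    calc _ < p ^ M + (R.filter fun u => m u = M).card * p ^ M := by gcongr
      _ = ((R.filter fun u => m u = M).card + 1) * p ^ M := by ring
      _ ≤ p * p ^ M := by gcongr
      _ = p ^ (M + 1) := by ring

lemma better_of (hm : Mult p m R) {P : ι} (hP : P ∈ R) (hmax : ∀ u ∈ R, m u ≤ m P) {b k : ℕ}
    (hk : 1 ≤ k) (h1 : φ' P = b) (h2 : φ P = b + k) (h3 : ∀ u ∈ R, φ' u ≤ φ u + k)
    (h4 : ∀ u ∈ R, m u = m P → φ' u ≤ φ u)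
    (h5 : ∀ u ∈ R, φ u < b ∨ φ' u < b → φ' u = φ u) : Better p m R φ φ' := by
  have hms := mult_sum hm (m P)
  refine ⟨⟨b, ?_, ?_⟩, ?_⟩
  · intro j hj
    apply Finset.sum_congr rfl
    intro u hu
    by_cases h : φ u < b ∨ φ' u < b
    · rw [h5 u hu h]
    · rw [if_neg (by omega), if_neg (by omega)]
  · have key : ∀ u ∈ R, (if φ u = b then p ^ m u else 0) + (if u = P then p ^ m P else 0) ≤
        (if φ' u = b then p ^ m u else 0) + (if m u < m P then p ^ m u else 0) := by
      intro u hu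
      by_cases huP : u = P
      · subst huP
        rw [if_neg (by omega), if_pos rfl, if_pos h1]; omega
      · rw [if_neg huP]
        by_cases hb : φ u = b
        · rw [if_pos hb]
          by_cases hb' : φ' u = b
          · rw [if_pos hb']; omega
          · have : m u < m P := by
              by_contra hlt
              have := h4 u hu (le_antisymm (hmax u hu) (not_lt.mp hlt))
              have := h5 u hu (Or.inr (by omega))
              omega
            rw [if_pos this]; omega
        · rw [if_neg hb]; simp
    have := Finset.sum_le_sum key
    rw [Finset.sum_add_distrib, Finset.sum_add_distrib, Finset.sum_ite_eq' R P, if_pos hP] at this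
    unfold Bs
    omega
  · have key : ∀ u ∈ R, φ' u * p ^ m u + (if u = P then k * p ^ m P else 0) ≤
        φ u * p ^ m u + k * (if m u < m P then p ^ m u else 0) := by
      intro u hu
      by_cases huP : u = P
      · subst huP
        rw [if_pos rfl, h1, h2, ← add_mul]; omega
      · rw [if_neg huP]
        by_cases hlt : m u < m P
        · rw [if_pos hlt, ← add_mul, add_zero]
          exact Nat.mul_le_mul_right _ (h3 u hu)
        · have := h4 u hu (le_antisymm (hmax u hu) (not_lt.mp hlt))
          rw [if_neg hlt, mul_zero, add_zero, add_zero]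
          exact Nat.mul_le_mul_right _ this
    have := Finset.sum_le_sum key
    rw [Finset.sum_add_distrib, Finset.sum_add_distrib, Finset.sum_ite_eq' R P, if_pos hP,
      ← Finset.mul_sum] at this
    have h7 := Nat.mul_lt_mul_of_pos_left hms (show 0 < k by omega)
    unfold wgt
    omega

lemma sum_swap {u v : ι} (hu : u ∈ R) (hv : v ∈ R) {M : Type*} [AddCommMonoid M] (g h : ι → M)
    (hgh : ∀ x, g x = h (Equiv.swap u v x)) : ∑ x ∈ R, g x = ∑ x ∈ R, h x := by
  refine Finset.sum_equiv (Equiv.swap u v) ?_ (fun x _ => hgh x)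
  intro x
  rcases eq_or_ne x u with rfl | h1
  · simp [hu, hv]
  · rcases eq_or_ne x v with rfl | h2
    · simp [hu, hv]
    · rw [Equiv.swap_apply_of_ne_of_ne h1 h2]

lemma ev_swap {u v : ι} (huv : ((m u : ℕ) : ZMod f) = m v) (x : ι) :
    ((m (Equiv.swap u v x) : ℕ) : ZMod f) = m x := by
  rcases eq_or_ne x u with rfl | h1
  · simp [huv]
  · rcases eq_or_ne x v with rfl | h2
    · simp [huv]
    · rw [Equiv.swap_apply_of_ne_of_ne h1 h2]

lemma m_swap {u v : ι} (huv : m u = m v) (x : ι) : m (Equiv.swap u v x) = m x := by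
  rcases eq_or_ne x u with rfl | h1
  · simp [huv]
  · rcases eq_or_ne x v with rfl | h2
    · simp [huv]
    · rw [Equiv.swap_apply_of_ne_of_ne h1 h2]

lemma cnt_swap {u v : ι} (hu : u ∈ R) (hv : v ∈ R) (huv : ((m u : ℕ) : ZMod f) = m v) (j : ℕ) :
    cnt f m R (φ ∘ Equiv.swap u v) j = cnt f m R φ j := by
  rw [cnt, cnt, vec, vec, Finset.sum_filter, Finset.sum_filter]
  apply sum_swap hu hv
  intro x
  rw [ev_swap huv, Function.comp]

lemma Bs_swap {u v : ι} (hu : u ∈ R) (hv : v ∈ R) (huv : m u = m v) (j : ℕ) :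
    Bs p m R (φ ∘ Equiv.swap u v) j = Bs p m R φ j := by
  apply sum_swap hu hv
  intro x
  rw [m_swap huv, Function.comp]

lemma wgt_swap {u v : ι} (hu : u ∈ R) (hv : v ∈ R) (huv : m u = m v) :
    wgt p m R (φ ∘ Equiv.swap u v) = wgt p m R φ := by
  apply sum_swap hu hv
  intro x
  rw [m_swap huv, Function.comp]

lemma swap_mem {u v : ι} (hu : u ∈ R) (hv : v ∈ R) {x : ι} (hx : x ∈ R) :
    Equiv.swap u v x ∈ R := by
  rcases eq_or_ne x u with rfl | h1
  · simp [hv]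
  · rcases eq_or_ne x v with rfl | h2
    · simp [hu]
    · rwa [Equiv.swap_apply_of_ne_of_ne h1 h2]

lemma Valid_swap {u v : ι} (hu : u ∈ R) (hv : v ∈ R) (huv : ((m u : ℕ) : ZMod f) = m v)
    (h : ValidY p m D R e φ Y) : ValidY p m D R e (φ ∘ Equiv.swap u v) Y := by
  refine ⟨fun x hx => h.1 _ (swap_mem hu hv hx), fun j hj => ?_⟩
  rw [cnt_swap hu hv huv]; exact h.2 j hj

lemma NI_swap {u v : ι} (hu : u ∈ R) (hv : v ∈ R) (huv : m u = m v)
    (h : NI p m D R e φ) : NI p m D R e (φ ∘ Equiv.swap u v) := by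
  obtain ⟨⟨Y, hY⟩, h2⟩ := h
  refine ⟨⟨Y, Valid_swap hu hv (by rw [huv]) hY⟩, ?_⟩
  intro φ' hφ' hb
  apply h2 φ' hφ'
  unfold Better at *
  simp only [Bs_swap hu hv huv, wgt_swap hu hv huv] at hb
  exact hb

end units
end Sheats

namespace Sheats
set_option linter.unusedSectionVars false

section units
variable {ι : Type*} [DecidableEq ι] {f : ℕ}
variable {m : ι → ℕ} {R : Finset ι} {φ φ' : ι → ℕ} {p D : ℕ} {e Y : ℕ → ZMod f → ℤ}

lemma vec_eq_sum_cnt (h : ∀ u ∈ R, φ u ≤ D) :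
    vec f m R = ∑ j ∈ Finset.range (D + 1), cnt f m R φ j := by
  unfold cnt vec
  rw [Finset.sum_fiberwise_of_maps_to]
  intro u hu
  exact Finset.mem_range.mpr (Nat.lt_succ_of_le (h u hu))

lemma slack_eq (hv : ValidY p m D R e φ Y) :
    slack m D R e = Eo p (∑ j ∈ Finset.range D, Y j) + cnt f m R φ D := by
  rw [slack, vec_eq_sum_cnt hv.1, Finset.sum_range_succ, Eo_sum]
  have : ∑ j ∈ Finset.range D, cnt f m R φ j = ∑ j ∈ Finset.range D, (e j + Eo p (Y j)) :=
    Finset.sum_congr rfl fun j hj => (hv.2 j (Finset.mem_range.mp hj)).2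
  rw [this, Finset.sum_add_distrib]
  abel

lemma Eo_tot_le (hv : ValidY p m D R e φ Y) :
    Eo p (∑ j ∈ Finset.range D, Y j) ≤ slack m D R e := by
  rw [slack_eq hv]
  exact le_add_of_nonneg_right (cnt_nonneg _)

lemma Y_le_tot (hv : ValidY p m D R e φ Y) {j : ℕ} (hj : j < D) :
    Y j ≤ ∑ j ∈ Finset.range D, Y j :=
  Finset.single_le_sum (fun k hk => (hv.2 k (Finset.mem_range.mp hk)).1) (Finset.mem_range.mpr hj)

lemma tot_nonneg (hv : ValidY p m D R e φ Y) : 0 ≤ ∑ j ∈ Finset.range D, Y j :=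
  Finset.sum_nonneg (fun k hk => (hv.2 k (Finset.mem_range.mp hk)).1)

lemma ev_le {l : ZMod f} {x : ZMod f → ℤ} (h0 : 0 ≤ x) (h1 : 1 ≤ x l) : ev l ≤ x := by
  intro z
  have := h0 z
  simp only [ev, Pi.zero_apply] at *
  split_ifs with hz
  · rw [hz]; exact h1
  · exact this

lemma one_le_cnt {P : ι} (hP : P ∈ R) {j : ℕ} (hj : φ P = j) :
    1 ≤ cnt f m R φ j (m P : ℕ) := by
  rw [cnt, vec_apply]
  have : 0 < ((R.filter fun u => φ u = j).filter fun u => ((m u : ℕ) : ZMod f) = (m P : ℕ)).card :=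
    Finset.card_pos.mpr ⟨P, by simp [hP, hj]⟩
  exact_mod_cast this

lemma Acc_of_mem (hv : ValidY p m D R e φ Y) {P : ι} (hP : P ∈ R) {j : ℕ} (hj : φ P = j)
    (hjD : j < D) : Acc p (slack m D R e) (e j) (m P : ℕ) := by
  refine ⟨_, Y j, (hv.2 j hjD).1, Y_le_tot hv hjD, Eo_tot_le hv, ?_⟩
  rw [← (hv.2 j hjD).2]
  exact ev_le (cnt_nonneg _) (one_le_cnt hP hj)

lemma Acc_of_Y (hp : 2 ≤ p) (hv : ValidY p m D R e φ Y) {j : ℕ} (hjD : j < D) (he : 0 ≤ e j)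
    {x : ZMod f} (hx : 1 ≤ Y j x) : Acc p (slack m D R e) (e j) x := by
  obtain ⟨hY0, hc⟩ := hv.2 j hjD
  have hc0 := cnt_nonneg (f := f) (m := m) (R := R) (φ := φ) j
  rw [hc] at hc0
  by_cases h1 : 1 ≤ (e j + Eo p (Y j)) x
  · exact ⟨_, Y j, hY0, Y_le_tot hv hjD, Eo_tot_le hv, ev_le hc0 h1⟩
  by_cases h2 : 1 ≤ e j x
  · refine ⟨_, 0, le_rfl, tot_nonneg hv, Eo_tot_le hv, ?_⟩
    rw [Eo_zero, add_zero]; exact ev_le he h2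
  refine ⟨_, fun z => min (Y j z) 1, ?_, ?_, Eo_tot_le hv, ?_⟩
  · intro z; exact le_min (hY0 z) (by norm_num)
  · intro z; exact (min_le_left _ _).trans (Y_le_tot hv hjD z)
  · have hpz : (2 : ℤ) ≤ p := by exact_mod_cast hp
    apply ev_le
    · intro z
      have b1 := hY0 z
      have b2 := hY0 (z+1)
      have b3 := hc0 z
      have b4 := he z
      simp only [Pi.add_apply, Pi.zero_apply, Eo] at *
      have c1 := min_le_left (Y j z) 1
      have c2 := min_le_right (Y j z) 1
      rcases le_or_gt 1 (Y j (z+1)) with h | h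
      · rw [min_eq_right h]; linarith
      · have : Y j (z+1) = 0 := by omega
        rw [this] at b3 ⊢
        rw [show min (0:ℤ) 1 = 0 by norm_num]; linarith
    · have b2 := hY0 (x+1)
      have b3 := hc0 x
      have b4 := he x
      simp only [Pi.add_apply, Pi.zero_apply, Eo] at *
      have : 1 ≤ Y j (x+1) := by
        by_contra h
        have : Y j (x+1) = 0 := by omega
        rw [this] at b3; linarith
      rw [min_eq_right this]
      have c2 := min_le_right (Y j x) 1
      linarith

lemma PR (hv : ValidY p m D R e φ Y) [NeZero f] {j k : ℕ} (hjD : j < D) (hjk : j < k)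
    (hkD : k ≤ D) {P : ι}
    (hP : P ∈ R) (hPk : φ P = k) {χ W : ZMod f → ℤ} (hχ0 : 0 ≤ χ)
    (hχ : ev ((m P : ℕ) : ZMod f) ≤ e j + Eo p χ)
    (hW : Eo p W ≤ cnt f m R φ k) (hWk : k < D → W ≤ Y k) (hχW : χ ≤ Y j + W) :
    ∃ φ', Valid p m D R e φ' ∧ φ' P = j ∧
      ∀ u ∈ R, φ' u = φ u ∨ ((φ u = j ∨ φ u = k) ∧ (φ' u = j ∨ φ' u = k)) := by
  have hcj := (hv.2 j hjD).2
  obtain ⟨y, hy0, hyV, hy1, hy2⟩ := exists_split (p := p) (Y j + W - χ)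
    (e j + Eo p χ - ev ((m P : ℕ) : ZMod f))
    (cnt f m R φ j + cnt f m R φ k - ev ((m P : ℕ) : ZMod f)) (sub_nonneg.mpr hχW)
    (sub_nonneg.mpr hχ) (by
      rw [sub_nonneg]
      exact (ev_le (cnt_nonneg _) (one_le_cnt hP hPk)).trans
        (le_add_of_nonneg_left (cnt_nonneg _))) (by
      rw [Eo_sub, Eo_add, hcj]
      intro l
      have := hW l
      simp only [Pi.add_apply, Pi.sub_apply] at *
      linarith)
  have hT : ev ((m P : ℕ) : ZMod f) ≤ e j + Eo p (χ + y) := by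
    intro l
    have := hy1 l
    rw [Eo_add]
    simp only [Pi.add_apply, Pi.sub_apply, Pi.zero_apply] at *
    linarith
  have hT2 : e j + Eo p (χ + y) ≤ cnt f m R φ j + cnt f m R φ k := by
    intro l
    have := hy2 l
    rw [Eo_add]
    simp only [Pi.add_apply, Pi.sub_apply] at *
    linarith
  obtain ⟨φ', h1, h2, h3, h4, h5⟩ := move (m := m) (R := R) (φ := φ) (hjk.ne) (Q := {P})
    (T := e j + Eo p (χ + y)) (by
      intro u hu
      rw [Finset.mem_singleton] at hu
      subst hu
      exact Finset.mem_filter.mpr ⟨hP, Or.inr hPk⟩) (by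
      rw [vec, Finset.sum_singleton]; exact hT) hT2
  refine ⟨φ', ⟨fun b => if b = j then χ + y else if b = k then Y k + Y j - χ - y else Y b,
    ?_, ?_⟩, h2 P (Finset.mem_singleton_self P), h1⟩
  · intro u hu
    have := hv.1 u hu
    rcases h1 u hu with h | ⟨_, h | h⟩ <;> omega
  · intro b hb
    by_cases hbj : b = j
    · subst hbj
      simp only [if_true]
      exact ⟨add_nonneg hχ0 hy0, h3⟩
    · by_cases hbk : b = k
      · subst hbk
        simp only [if_neg hbj, if_true]
        refine ⟨?_, ?_⟩
        · intro l
          have a1 := hyV l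
          have a2 := hWk hb l
          simp only [Pi.add_apply, Pi.sub_apply, Pi.zero_apply] at *
          linarith
        · rw [h4, hcj, (hv.2 b hb).2, Eo_sub, Eo_sub, Eo_add, Eo_add]
          abel
      · simp only [if_neg hbj, if_neg hbk]
        rw [h5 b hbj hbk]
        exact hv.2 b hb

lemma sorted (hm : Mult p m R) (hNI : NI p m D R e φ) {u v : ι} (hu : u ∈ R) (hv : v ∈ R)
    (hmax : ∀ x ∈ R, m x ≤ m u) (huv : ((m u : ℕ) : ZMod f) = m v) (hlt : m v < m u) :
    φ u ≤ φ v := by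
  by_contra hgt
  push Not at hgt
  obtain ⟨⟨Y, hY⟩, h2⟩ := hNI
  have hne : u ≠ v := fun h => by rw [h] at hlt; exact lt_irrefl _ hlt
  refine h2 _ ⟨Y, Valid_swap hu hv huv hY⟩ (better_of hm hu hmax (b := φ v) (k := φ u - φ v)
    (by omega) (by simp) (by omega) ?_ ?_ ?_)
  · intro x hx
    rcases eq_or_ne x u with rfl | h1
    · simp; omega
    · rcases eq_or_ne x v with rfl | h2
      · simp; omega
      · simp only [Function.comp, Equiv.swap_apply_of_ne_of_ne h1 h2]; omega
  · intro x hx hmx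
    rcases eq_or_ne x u with rfl | h1
    · simp; omega
    · rcases eq_or_ne x v with rfl | h2
      · omega
      · simp only [Function.comp, Equiv.swap_apply_of_ne_of_ne h1 h2]; omega
  · intro x hx
    rcases eq_or_ne x u with rfl | h1
    · simp; omega
    · rcases eq_or_ne x v with rfl | h2
      · simp; omega
      · simp only [Function.comp, Equiv.swap_apply_of_ne_of_ne h1 h2]; simp

end units
end Sheats

namespace Sheats
set_option linter.unusedSectionVars false

section units
variable {ι : Type*} [DecidableEq ι] {f : ℕ}
variable {m : ι → ℕ} {R : Finset ι} {φ φ' : ι → ℕ} {p D : ℕ} {e Y : ℕ → ZMod f → ℤ}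

/-- The supply statement at level `t`. -/
def Sup (p : ℕ) {f : ℕ} (m : ι → ℕ) (D : ℕ) (R : Finset ι) (e : ℕ → ZMod f → ℤ) (φ : ι → ℕ)
    (Y : ℕ → ZMod f → ℤ) (M b : ℕ) (χ : ZMod f → ℤ) (t : ℕ) : Prop :=
  ∃ (φ' : ι → ℕ) (W : ZMod f → ℤ) (Y' : ℕ → ZMod f → ℤ), ValidY p m D R e φ' Y' ∧
    (∀ j, j ≤ t → Y' j = Y j) ∧ (t + 1 < D → W ≤ Y' (t + 1)) ∧ 0 ≤ W ∧
    (∀ u ∈ R, φ u ≤ t ∨ φ' u ≤ t → φ' u = φ u) ∧ (∀ u ∈ R, φ' u ≤ φ u + 1) ∧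
    (∀ u ∈ R, m u = M → φ' u ≤ φ u) ∧ Eo p W ≤ cnt f m R φ' (t + 1) ∧
    χ ≤ W + ∑ j ∈ Finset.Ico b (t + 1), Y j

lemma sup_base (hp : 2 ≤ p) (hInv : Inv p m D R e) (hv : ValidY p m D R e φ Y) {i : ZMod f}
    {M b : ℕ} (hb : b < D) {χ : ZMod f → ℤ} (h0 : 0 ≤ χ) (h1 : χ ≤ 1)
    (hχ : ev i ≤ e b + Eo p χ) (hmin : ∀ y, 0 ≤ y → ev i ≤ e b + Eo p y → χ ≤ y)
    (hacc : Acc p (slack m D R e) (e b) i)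
    (hn : ∀ j, j < b → ¬ Acc p (slack m D R e) (e j) i) {t : ℕ} (ht : t + 1 = D) :
    Sup p m D R e φ Y M b χ t := by
  obtain ⟨Y0, y, hy0, hyY, hY0, hy⟩ := hacc
  have hχY : χ ≤ Y0 := (hmin y hy0 hy).trans hyY
  set Yt := ∑ j ∈ Finset.range D, Y j with hYt
  refine ⟨φ, (Y0 ⊔ Yt) - Yt, Y, hv, fun _ _ => rfl, fun h => absurd h (by omega),
    sub_nonneg.mpr le_sup_right, fun _ _ _ => rfl, fun _ _ => Nat.le_succ _,
    fun _ _ _ => le_rfl, ?_, ?_⟩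
  · have := Eo_sup hY0 (Eo_tot_le hv)
    rw [ht, Eo_sub, sub_le_iff_le_add, add_comm, ← slack_eq hv]
    exact this
  · rw [ht]
    have hz : ∀ l, 1 ≤ χ l → ∀ j, j < b → Y j l = 0 := by
      intro l hl j hj
      by_contra hne
      have hjD : j < D := by omega
      have a := (hv.2 j hjD).1 l
      simp only [Pi.zero_apply] at a
      have hA := Acc_of_Y hp hv hjD (hInv.1 j hjD) (x := l) (by omega)
      have := chi_zero (e b) χ i h0 h1 hχ hmin (fun x => Acc p (slack m D R e) (e j) x)
        (fun x hx hx1 => Acc_pred hp (hInv.1 j hjD) hx hY0 (hx1.trans (hχY x)))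
        (hn j hj) (fun x hx => hInv.2 j b hj hb x hx) l hA
      omega
    intro l
    have a1 := h0 l
    have a2 := hχY l
    have a3 : Y0 l ≤ (Y0 ⊔ Yt) l := le_sup_left (a := Y0) (b := Yt) l
    have a4 : Yt l ≤ (Y0 ⊔ Yt) l := le_sup_right (a := Y0) (b := Yt) l
    have a5 : Yt = ∑ j ∈ Finset.range b, Y j + ∑ j ∈ Finset.Ico b D, Y j := by
      rw [hYt, Finset.sum_range_add_sum_Ico _ hb.le]
    have a6 : 0 ≤ ∑ j ∈ Finset.Ico b D, Y j :=
      Finset.sum_nonneg fun j hj => (hv.2 j (Finset.mem_Ico.mp hj).2).1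
    have a7 := a6 l
    simp only [Pi.add_apply, Pi.sub_apply, Pi.zero_apply] at *
    by_cases hl : 1 ≤ χ l
    · have : (∑ j ∈ Finset.range b, Y j) l = 0 := by
        rw [Finset.sum_apply]
        exact Finset.sum_eq_zero fun j hj => hz l hl j (Finset.mem_range.mp hj)
      have a8 := congrFun a5 l
      rw [Pi.add_apply, this] at a8
      linarith
    · linarith

lemma sup_step [NeZero f] (hp : 2 ≤ p) (hInv : Inv p m D R e) (hv : ValidY p m D R e φ Y)
    (hm : Mult p m R) {M b : ℕ} {i : ZMod f} (hMi : (M : ZMod f) = i)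
    (hsort : ∀ u ∈ R, ∀ v ∈ R, m u = M → m v ≠ M → ((m v : ℕ) : ZMod f) = i → φ u ≤ φ v)
    {χ : ZMod f → ℤ} (h0 : 0 ≤ χ) (h1 : χ ≤ 1)
    (hχ : ev i ≤ e b + Eo p χ) (hmin : ∀ y, 0 ≤ y → ev i ≤ e b + Eo p y → χ ≤ y)
    (hacc : Acc p (slack m D R e) (e b) i)
    {t : ℕ} (hbt : b < t) (ht : t < D) (hS : Sup p m D R e φ Y M b χ t) :
    Sup p m D R e φ Y M b χ (t - 1) := by
  classical
  obtain ⟨φ', W, Y', hv', hYY, hWY, hW0, hun, hd1, hdP, hEW, hχW⟩ := hS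
  have hpz : (2 : ℤ) ≤ p := by exact_mod_cast hp
  have hbD : b < D := hbt.trans ht
  -- sums of certificates
  set sb := ∑ j ∈ Finset.Ico b (t + 1), Y j with hs
  have hY0 : ∀ j, j < D → ∀ l, 0 ≤ Y j l := fun j hj l => (hv.2 j hj).1 l
  have hs0 : ∀ l, 0 ≤ sb l := by
    intro l
    rw [hs, Finset.sum_apply]
    exact Finset.sum_nonneg fun j hj => hY0 j (by have := Finset.mem_Ico.mp hj; omega) l
  have hYs : ∀ j, b ≤ j → j ≤ t → ∀ l, Y j l ≤ sb l := by
    intro j hj hj' l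
    rw [hs, Finset.sum_apply]
    exact Finset.single_le_sum (f := fun j => Y j l)
      (fun k hk => hY0 k (by have := Finset.mem_Ico.mp hk; omega) l)
      (Finset.mem_Ico.mpr ⟨hj, by omega⟩)
  let ν : ZMod f → ℤ := fun l => if sb l < χ l then 1 else 0
  obtain ⟨w, hw1, hw2, hw3, hw4⟩ := exists_min_w (p := p) hp ν W (cnt f m R φ' (t + 1))
    (by intro l; simp only [ν, Pi.zero_apply]; split_ifs <;> norm_num)
    (by intro l; simp only [ν, Pi.one_apply]; split_ifs <;> norm_num)
    (by
      intro l
      have a := hχW l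
      have a0 := hW0 l
      simp only [ν, Pi.add_apply, Pi.zero_apply] at *
      split_ifs with h
      · omega
      · exact a0) (cnt_nonneg _) hEW
  have hw0 : ∀ l, 0 ≤ w l := by
    intro l
    refine le_trans ?_ (hw1 l)
    simp only [ν]; split_ifs <;> norm_num
  -- acceptance along the support of chi
  obtain ⟨Y0, y, hy0, hyY, hY0s, hy⟩ := hacc
  have hχY : χ ≤ Y0 := (hmin y hy0 hy).trans hyY
  have heb := hInv.1 b hbD
  have hE0 : 0 ≤ e b + Eo p χ := by
    refine le_trans ?_ hχ
    intro l; simp only [ev, Pi.zero_apply]; split_ifs <;> norm_num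
  have hAccχ : ∀ l, 1 ≤ χ l → Acc p (slack m D R e) (e b) l := by
    intro l hl
    by_cases hc : 1 ≤ χ (l + 1)
    · refine ⟨Y0, χ, h0, hχY, hY0s, ev_le hE0 ?_⟩
      have b1 := heb l
      have b2 := h1 l
      simp only [Pi.add_apply, Eo, Pi.zero_apply, Pi.one_apply] at *
      nlinarith
    · refine ⟨Y0, 0, le_rfl, h0.trans hχY, hY0s, ?_⟩
      rw [Eo_zero, add_zero]
      refine ev_le heb ?_
      have b1 := hE0 l
      have b3 := h0 (l + 1)
      simp only [Pi.add_apply, Eo, Pi.zero_apply] at *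
      have : χ (l + 1) = 0 := by omega
      rw [this] at b1
      linarith
  have hcnt : ∀ j, j ≤ t → cnt f m R φ' j = cnt f m R φ j := by
    intro j hj
    rw [cnt, cnt]
    congr 1
    apply Finset.filter_congr
    intro u hu
    constructor
    · intro h; rw [← hun u hu (Or.inr (by omega))]; exact h
    · intro h; rw [hun u hu (Or.inl (by omega))]; exact h
  have hct : cnt f m R φ t = e t + Eo p (Y t) := (hv.2 t ht).2
  have hct1 : ∀ l, 1 ≤ χ l → Y t l = 0 → 1 ≤ cnt f m R φ t l := by
    intro l hl hz
    have a1 := hInv.2 b t hbt ht l (hAccχ l hl)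
    have a2 := hY0 t ht (l + 1)
    rw [hct]
    simp only [Pi.add_apply, Eo]
    rw [hz]
    nlinarith
  let Q : Finset ι := R.filter fun u => φ' u = t ∧ m u = M
  have hQt : Q ⊆ R.filter fun u => φ' u = t := by
    intro u hu
    have := Finset.mem_filter.mp hu
    exact Finset.mem_filter.mpr ⟨this.1, this.2.1⟩
  have hQT : vec f m Q ≤ cnt f m R φ' t + Eo p w := by
    intro l
    have a1 : vec f m Q l ≤ cnt f m R φ' t l := vec_mono hQt l
    rw [Pi.add_apply]
    rcases le_or_gt 0 (Eo p w l) with hl | hl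
    · linarith
    obtain ⟨c1, c2, c3⟩ := hw4 l hl
    have c4 : Eo p w l = -1 := by simp only [Eo, c2, c3]; ring
    rw [c4]
    have hlt : sb l < χ l := by
      by_contra h
      simp only [ν, if_neg h] at c1
      omega
    have hχl : χ l = 1 := by
      have := hs0 l
      have := h1 l
      simp only [Pi.one_apply] at this
      omega
    have hsl : sb l = 0 := by have := hs0 l; omega
    have hYl : ∀ j, b ≤ j → j ≤ t → Y j l = 0 := by
      intro j hj hj'
      have b1 := hYs j hj hj' l
      have b2 := hY0 j (by omega) l
      omega
    have d1 := hct1 l (by omega) (hYl t hbt.le le_rfl)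
    rw [hcnt t le_rfl] at a1 ⊢
    suffices h : vec f m Q l ≠ cnt f m R φ t l by
      change vec f m Q l ≤ cnt f m R φ t l + -1
      omega
    intro heq
    have hcard := heq
    by_cases hli : l = i
    · subst hli
      -- all class-`i` units of bin `t` are of maximal size
      have hall : ∀ u ∈ R, φ u = t → ((m u : ℕ) : ZMod f) = l → m u = M := by
        intro u hu hut hul
        rw [cnt, vec_apply, vec_apply] at hcard
        have hQt2 : Q ⊆ R.filter fun u => φ u = t := by
          intro x hx
          have := Finset.mem_filter.mp hx
          exact Finset.mem_filter.mpr ⟨this.1, by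
            rw [← hun x this.1 (Or.inr this.2.1.le)]; exact this.2.1⟩
        have hss := Finset.eq_of_subset_of_card_le
          (Finset.filter_subset_filter (fun u => ((m u : ℕ) : ZMod f) = l) hQt2)
          (Int.ofNat_le.mp hcard.ge)
        have hu2 : u ∈ (R.filter fun u => φ u = t).filter fun u => ((m u : ℕ) : ZMod f) = l := by
          simp [hu, hut, hul]
        rw [← hss] at hu2
        exact (Finset.mem_filter.mp (Finset.mem_filter.mp hu2).1).2.2
      obtain ⟨u0, hu0⟩ : ∃ u ∈ R, φ u = t ∧ ((m u : ℕ) : ZMod f) = l := by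
        rw [cnt, vec_apply] at d1
        have : 0 < ((R.filter fun u => φ u = t).filter
            fun u => ((m u : ℕ) : ZMod f) = l).card := by exact_mod_cast d1
        obtain ⟨u, hu⟩ := Finset.card_pos.mp this
        have h1 := Finset.mem_filter.mp hu
        have h2 := Finset.mem_filter.mp h1.1
        exact ⟨u, h2.1, h2.2, h1.2⟩
      have hu0M := hall u0 hu0.1 hu0.2.1 hu0.2.2
      have hall2 : ∀ v ∈ R, φ v ≤ t → ((m v : ℕ) : ZMod f) = l → m v = M := by
        intro v hv hvt hvl
        by_contra hne
        have := hsort u0 hu0.1 v hv hu0M hne hvl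
        rw [hu0.2.1] at this
        exact hne (hall v hv (le_antisymm hvt this) hvl)
      -- chi at the next class
      have hχ1 : 1 ≤ χ (l + 1) := by
        by_contra h
        have b3 := h0 (l + 1)
        simp only [Pi.zero_apply] at b3
        have hz : χ (l + 1) = 0 := by omega
        have b1 := hχ l
        simp only [ev, if_true, Pi.add_apply, Eo, hz, hχl] at b1
        have := hmin 0 le_rfl (by
          rw [Eo_zero, add_zero]; exact ev_le heb (by linarith)) l
        rw [hχl] at this
        simp at this
      have hν1 : χ (l + 1) ≤ sb (l + 1) := by
        by_contra h
        have := hw1 (l + 1)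
        simp only [ν, if_pos (not_le.mp h)] at this
        omega
      have hge : (p : ℤ) ≤ ∑ j ∈ Finset.Ico b (t + 1), cnt f m R φ j l := by
        have hj : ∀ j ∈ Finset.Ico b (t + 1), (p : ℤ) * Y j (l + 1) ≤ cnt f m R φ j l := by
          intro j hj
          have hj' := Finset.mem_Ico.mp hj
          rw [(hv.2 j (by omega)).2]
          have b1 := hInv.1 j (by omega) l
          simp only [Pi.add_apply, Eo, Pi.zero_apply] at *
          rw [hYl j hj'.1 (by omega)]
          linarith
        refine le_trans ?_ (Finset.sum_le_sum hj)
        rw [← Finset.mul_sum]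
        have : sb (l + 1) = ∑ j ∈ Finset.Ico b (t + 1), Y j (l + 1) := by
          rw [hs, Finset.sum_apply]
        rw [← this]
        nlinarith
      have hle : ∑ j ∈ Finset.Ico b (t + 1), cnt f m R φ j l ≤
          ((R.filter fun u => m u = M).card : ℤ) := by
        have : ∀ j ∈ Finset.Ico b (t + 1), cnt f m R φ j l ≤
            (((R.filter fun u => m u = M).filter fun u => φ u = j).card : ℤ) := by
          intro j hj
          have hj' := Finset.mem_Ico.mp hj
          rw [cnt, vec_apply]
          apply Int.ofNat_le.mpr
          apply Finset.card_le_card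
          intro u hu
          have e1 := Finset.mem_filter.mp hu
          have e2 := Finset.mem_filter.mp e1.1
          exact Finset.mem_filter.mpr ⟨Finset.mem_filter.mpr
            ⟨e2.1, hall2 u e2.1 (by omega) e1.2⟩, e2.2⟩
        refine (Finset.sum_le_sum this).trans ?_
        have h9 := Finset.sum_card_fiberwise_eq_card_filter (R.filter fun u => m u = M)
          (Finset.Ico b (t + 1)) φ
        have h10 := Finset.card_filter_le (R.filter fun u => m u = M)
          (fun u => φ u ∈ Finset.Ico b (t + 1))
        rw [← h9] at h10
        exact_mod_cast h10
      have := hm M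
      omega
    · have : vec f m Q l = 0 := by
        rw [vec_apply]
        have : (Q.filter fun u => ((m u : ℕ) : ZMod f) = l) = ∅ := by
          apply Finset.filter_eq_empty_iff.mpr
          intro u hu h
          have := (Finset.mem_filter.mp hu).2.2
          rw [this, hMi] at h
          exact hli h.symm
        rw [this]; simp
      omega
  obtain ⟨φ'', k1, k2, k3, k4, k5⟩ := move (m := m) (R := R) (φ := φ')
    (show t ≠ t + 1 by omega) (Q := Q) (T := cnt f m R φ' t + Eo p w)
    (by
      intro u hu
      have := Finset.mem_filter.mp hu
      exact Finset.mem_filter.mpr ⟨this.1, Or.inl this.2.1⟩) hQT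
    (by
      intro l
      have := hw3 l
      simp only [Pi.add_apply]
      linarith)
  have htt : t - 1 + 1 = t := by omega
  refine ⟨φ'', Y t + w, fun j => if j = t then Y t + w else if j = t + 1 then Y' (t + 1) - w
    else Y' j, ⟨?_, ?_⟩, ?_, ?_, ?_, ?_, ?_, ?_, ?_, ?_⟩
  · intro u hu
    have := hv'.1 u hu
    rcases k1 u hu with h | ⟨h, h' | h'⟩
    · omega
    · omega
    · -- moved into bin `t + 1`, at most `D`
      omega
  · intro j hj
    by_cases hjt : j = t
    · subst hjt
      simp only [if_true]
      refine ⟨fun l => add_nonneg (hY0 j hj l) (hw0 l), ?_⟩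
      rw [k3, hcnt j le_rfl, hct, Eo_add]; abel
    · by_cases hjt' : j = t + 1
      · subst hjt'
        simp only [if_neg hjt, if_true]
        refine ⟨sub_nonneg.mpr (hw2.trans (hWY hj)), ?_⟩
        rw [k4, (hv'.2 _ hj).2, Eo_sub]; abel
      · simp only [if_neg hjt, if_neg hjt']
        rw [k5 j hjt hjt']
        exact hv'.2 j hj
  · intro j hj
    simp only [if_neg (show j ≠ t by omega), if_neg (show j ≠ t + 1 by omega)]
    exact hYY j (by omega)
  · intro _
    rw [htt]; simp
  · intro l
    exact add_nonneg (hY0 t ht l) (hw0 l)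
  · intro u hu h
    have e1 := hun u hu
    rcases k1 u hu with h3 | ⟨h3, h4⟩
    · rw [h3]; apply e1; omega
    · exfalso
      rcases h with h | h
      · have := e1 (Or.inl (by omega)); omega
      · omega
  · intro u hu
    have e1 := hun u hu
    have e2 := hd1 u hu
    rcases k1 u hu with h3 | ⟨h3, h4⟩
    · omega
    · rcases h3 with h3 | h3
      · have := e1 (Or.inr (by omega)); omega
      · omega
  · intro u hu hM
    have e1 := hun u hu
    have e2 := hdP u hu hM
    rcases k1 u hu with h3 | ⟨h3, h4⟩
    · omega
    · rcases h3 with h3 | h3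
      · have := k2 u (Finset.mem_filter.mpr ⟨hu, h3, hM⟩); omega
      · omega
  · rw [htt, k3, hcnt t le_rfl, hct, Eo_add]
    intro l
    have := hInv.1 t ht l
    simp only [Pi.add_apply, Pi.zero_apply] at *
    linarith
  · rw [htt]
    have hs2 : sb = ∑ j ∈ Finset.Ico b t, Y j + Y t := by
      rw [hs, Finset.sum_Ico_succ_top hbt.le]
    intro l
    have b1 := hw1 l
    have b2 := h1 l
    have b3 := congrFun hs2 l
    have b4 := hs0 l
    have b5 := hw0 l
    simp only [Pi.add_apply, Pi.one_apply, ν] at *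
    split_ifs at b1 with h
    · linarith
    · linarith

end units
end Sheats

namespace Sheats
set_option linter.unusedSectionVars false

section units
variable {ι : Type*} [DecidableEq ι] {f : ℕ}
variable {m : ι → ℕ} {R : Finset ι} {φ φ' : ι → ℕ} {p D : ℕ} {e Y : ℕ → ZMod f → ℤ}

lemma exchange [NeZero f] (hp : 2 ≤ p) (hInv : Inv p m D R e) (hm : Mult p m R)
    (hNI : NI p m D R e φ) {P : ι} (hP : P ∈ R) (hmax : ∀ u ∈ R, m u ≤ m P) {b : ℕ} (hb : b < D)
    (hacc : Acc p (slack m D R e) (e b) (m P : ℕ))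
    (hn : ∀ j, j < b → ¬ Acc p (slack m D R e) (e j) (m P : ℕ)) :
    ∃ P' ∈ R, m P' = m P ∧ φ P' = b := by
  by_contra hno
  push Not at hno
  obtain ⟨⟨Y, hv⟩, hNB⟩ := id hNI
  have hgt : ∀ u ∈ R, m u = m P → b < φ u := by
    intro u hu hmu
    rcases lt_trichotomy (φ u) b with h | h | h
    · exfalso
      apply hn (φ u) h
      rw [← hmu]
      exact Acc_of_mem hv hu rfl (h.trans hb)
    · exact absurd h (hno u hu hmu)
    · exact h
  by_cases h1 : ∃ P' ∈ R, m P' = m P ∧ φ P' = b + 1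
  · obtain ⟨P', hP', hmP', hφP'⟩ := h1
    obtain ⟨χ, c0, c1, c2, c3⟩ := exists_least (f := f) hp (e b) (hInv.1 b hb) (m P : ℕ)
    have hsup : ∀ n t, t + n + 1 = D → b ≤ t → Sup p m D R e φ Y (m P) b χ t := by
      intro n
      induction n with
      | zero =>
        intro t ht hbt
        exact sup_base hp hInv hv hb c0 c1 c2 c3 hacc hn ht
      | succ n ih =>
        intro t ht hbt
        have := ih (t + 1) (by omega) (by omega)
        have h2 := sup_step hp hInv hv hm rfl (fun u hu v hv' hmu hmv hc =>
          sorted (f := f) hm hNI hu hv' (fun x hx => hmu ▸ hmax x hx) (by rw [hmu, hc])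
            (by rw [hmu]; exact lt_of_le_of_ne (hmax v hv') hmv))
          c0 c1 c2 c3 hacc (t := t + 1) (by omega) (by omega) this
        simpa using h2
    obtain ⟨φ', W, Y', hv', hYY, hWY, hW0, hun, hd1, hdP, hEW, hχW⟩ :=
      hsup (D - 1 - b) b (by omega) le_rfl
    have hφ'P : φ' P' = b + 1 := by
      have a1 := hdP P' hP' hmP'
      have a2 := hun P' hP'
      by_contra hne
      have := a2 (Or.inr (by omega))
      omega
    obtain ⟨φ'', hV, hb'', hch⟩ := PR hv' hb (Nat.lt_succ_self b) hb hP' hφ'P c0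
      (by rw [hmP']; exact c2) hEW hWY (by
        rw [hYY b le_rfl]
        simp only [Nat.Ico_succ_singleton, Finset.sum_singleton] at hχW
        rw [add_comm]; exact hχW)
    apply hNB φ'' hV
    apply better_of hm hP' (fun u hu => hmP' ▸ hmax u hu) (b := b) (k := 1) le_rfl hb'' hφP'
    · intro u hu
      have a1 := hun u hu
      have a2 := hd1 u hu
      rcases hch u hu with h | ⟨h, h'⟩
      · omega
      · rcases h with h | h
        · have := a1 (Or.inr (by omega)); omega
        · omega
    · intro u hu hmu
      have a1 := hun u hu
      rw [hmP'] at hmu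
      have a2 := hdP u hu hmu
      have a3 := hgt u hu hmu
      rcases hch u hu with h | ⟨h, h'⟩
      · omega
      · rcases h with h | h
        · have := a1 (Or.inr (by omega)); omega
        · omega
    · intro u hu hlt
      have a1 := hun u hu
      rcases hch u hu with h | ⟨h, h'⟩
      · rw [h]; apply a1; omega
      · rcases hlt with hlt | hlt
        · have := a1 (Or.inl (by omega)); omega
        · omega
  · push Not at h1
    have hgt2 : ∀ u ∈ R, m u = m P → b + 1 < φ u := by
      intro u hu hmu
      have := hgt u hu hmu
      have := h1 u hu hmu
      omega
    have hPD := hv.1 P hP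
    have hPb := hgt2 P hP rfl
    have hb1 : b + 1 < D := by omega
    obtain ⟨φ'', hV, hb'', hch⟩ := PR hv hb1 hPb hPD hP rfl (χ := 0) (W := 0) le_rfl
      (by
        rw [Eo_zero, add_zero]
        exact ev_le (hInv.1 _ hb1) (hInv.2 b (b + 1) (Nat.lt_succ_self b) hb1 _ hacc))
      (by rw [Eo_zero]; exact cnt_nonneg _) (fun h => (hv.2 _ h).1)
      (by rw [add_zero]; exact (hv.2 _ hb1).1)
    apply hNB φ'' hV
    apply better_of hm hP hmax (b := b + 1) (k := φ P - (b + 1)) (by omega) hb'' (by omega)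
    · intro u hu
      rcases hch u hu with h | ⟨h, h'⟩ <;> omega
    · intro u hu hmu
      have := hgt2 u hu hmu
      rcases hch u hu with h | ⟨h, h'⟩ <;> omega
    · intro u hu hlt
      rcases hch u hu with h | ⟨h, h'⟩ <;> omega

lemma cnt_congr (h : ∀ u ∈ R, φ u = φ' u) (j : ℕ) : cnt f m R φ j = cnt f m R φ' j := by
  rw [cnt, cnt]; congr 1
  exact Finset.filter_congr fun u hu => by rw [h u hu]

lemma Bs_congr (h : ∀ u ∈ R, φ u = φ' u) (j : ℕ) : Bs p m R φ j = Bs p m R φ' j :=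
  Finset.sum_congr rfl fun u hu => by rw [h u hu]

lemma wgt_congr (h : ∀ u ∈ R, φ u = φ' u) : wgt p m R φ = wgt p m R φ' :=
  Finset.sum_congr rfl fun u hu => by rw [h u hu]

lemma ValidY_congr (h : ∀ u ∈ R, φ u = φ' u) (hv : ValidY p m D R e φ Y) :
    ValidY p m D R e φ' Y := by
  refine ⟨fun u hu => by rw [← h u hu]; exact hv.1 u hu, fun j hj => ?_⟩
  rw [← cnt_congr h]; exact hv.2 j hj

lemma cnt_erase {P : ι} (hP : P ∈ R) (j : ℕ) : cnt f m R φ j =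
    cnt f m (R.erase P) φ j + if φ P = j then ev ((m P : ℕ) : ZMod f) else 0 := by
  rw [cnt, cnt, vec, vec, Finset.sum_filter, Finset.sum_filter, Finset.sum_erase_add _ _ hP]

lemma Bs_erase {P : ι} (hP : P ∈ R) (j : ℕ) : Bs p m R φ j =
    Bs p m (R.erase P) φ j + if φ P = j then p ^ m P else 0 := by
  rw [Bs, Bs, Finset.sum_erase_add _ _ hP]

lemma wgt_erase {P : ι} (hP : P ∈ R) : wgt p m R φ =
    wgt p m (R.erase P) φ + φ P * p ^ m P := by
  rw [wgt, wgt, Finset.sum_erase_add _ _ hP]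

lemma vec_erase {P : ι} (hP : P ∈ R) : vec f m R =
    vec f m (R.erase P) + ev ((m P : ℕ) : ZMod f) := by
  rw [vec, vec, Finset.sum_erase_add _ _ hP]

lemma NI_erase {P : ι} (hP : P ∈ R) {b : ℕ} {e' : ℕ → ZMod f → ℤ} (hφ : φ P = b)
    (h1 : Valid p m D R e φ → Valid p m D (R.erase P) e' φ)
    (h2 : ∀ φ' : ι → ℕ, φ' P = b → Valid p m D (R.erase P) e' φ' → Valid p m D R e φ')
    (hNI : NI p m D R e φ) : NI p m D (R.erase P) e' φ := by
  refine ⟨h1 hNI.1, ?_⟩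
  rintro φ' ⟨Y, hY⟩ ⟨⟨c, hc1, hc2⟩, hw⟩
  have hag : ∀ u ∈ R.erase P, φ' u = Function.update φ' P b u := by
    intro u hu
    rw [Function.update_of_ne (Finset.ne_of_mem_erase hu)]
  have hup : Function.update φ' P b P = b := Function.update_self ..
  refine hNI.2 (Function.update φ' P b) (h2 _ hup ⟨Y, ValidY_congr hag hY⟩) ⟨⟨c, ?_, ?_⟩, ?_⟩
  · intro j hj
    rw [Bs_erase hP, Bs_erase hP, hup, hφ, ← Bs_congr hag, hc1 j hj]
  · rw [Bs_erase hP, Bs_erase (φ := Function.update φ' P b) hP, hup, hφ, ← Bs_congr hag]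
    omega
  · rw [wgt_erase hP, wgt_erase (φ := φ) hP, hup, hφ, ← wgt_congr hag]
    omega

lemma Mult_erase (h : Mult p m R) (P : ι) : Mult p m (R.erase P) := fun a =>
  lt_of_le_of_lt (Finset.card_le_card
    (Finset.filter_subset_filter _ (Finset.erase_subset P R))) (h a)

lemma ev_nonneg (i : ZMod f) : 0 ≤ ev i := by
  intro l; simp only [ev, Pi.zero_apply]; split_ifs <;> norm_num

lemma core [NeZero f] (hp : 2 ≤ p) : ∀ (n : ℕ) (R : Finset ι) (e : ℕ → ZMod f → ℤ)
    (φ ψ : ι → ℕ), R.card = n → Inv p m D R e → Mult p m R → NI p m D R e φ → NI p m D R e ψ →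
    ∀ j, Bs p m R φ j = Bs p m R ψ j := by
  intro n
  induction n with
  | zero =>
    intro R e φ ψ hR _ _ _ _ j
    rw [Finset.card_eq_zero.mp hR]; simp [Bs]
  | succ n ih =>
    intro R e φ ψ hR hInv hm hφ hψ j
    obtain ⟨P, hP, hmax⟩ := Finset.exists_max_image R m (Finset.card_pos.mp (by omega))
    have hcard : (R.erase P).card = n := by rw [Finset.card_erase_of_mem hP]; omega
    by_cases hex : ∃ b, b < D ∧ Acc p (slack m D R e) (e b) (m P : ℕ)
    · classical
      obtain ⟨hb, hacc⟩ := Nat.find_spec hex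
      have hmin := fun k => Nat.find_min hex (m := k)
      set b := Nat.find hex with hbdef
      have hn : ∀ j, j < b → ¬ Acc p (slack m D R e) (e j) (m P : ℕ) :=
        fun j hj h => hmin j hj ⟨hj.trans hb, h⟩
      obtain ⟨P1, hP1, hm1, hb1⟩ := exchange hp hInv hm hφ hP hmax hb hacc hn
      obtain ⟨P2, hP2, hm2, hb2⟩ := exchange hp hInv hm hψ hP hmax hb hacc hn
      have hφ1 := NI_swap hP hP1 hm1.symm hφ
      have hψ1 := NI_swap hP hP2 hm2.symm hψ
      rw [← Bs_swap hP hP1 hm1.symm, ← Bs_swap (φ := ψ) hP hP2 hm2.symm]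
      have hφb : (φ ∘ Equiv.swap P P1) P = b := by simp [hb1]
      have hψb : (ψ ∘ Equiv.swap P P2) P = b := by simp [hb2]
      generalize φ ∘ Equiv.swap P P1 = φ1 at *
      generalize ψ ∘ Equiv.swap P P2 = ψ1 at *
      obtain ⟨χ, c0, c1, c2, c3⟩ := exists_least (f := f) hp (e b) (hInv.1 b hb) (m P : ℕ)
      let e' := Function.update e b (e b + Eo p χ - ev ((m P : ℕ) : ZMod f))
      have he'b : e' b = e b + Eo p χ - ev ((m P : ℕ) : ZMod f) := Function.update_self ..
      have he' : ∀ k, k ≠ b → e' k = e k := fun k hk => Function.update_of_ne hk ..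
      have T1 : ∀ φ' : ι → ℕ, φ' P = b → Valid p m D R e φ' → Valid p m D (R.erase P) e' φ' := by
        rintro φ' hb' ⟨Y, hY⟩
        refine ⟨Function.update Y b (Y b - χ), fun u hu => hY.1 u (Finset.mem_of_mem_erase hu), ?_⟩
        intro k hk
        obtain ⟨d1, d2⟩ := hY.2 k hk
        by_cases hkb : k = b
        · subst hkb
          rw [Function.update_self, he'b]
          refine ⟨sub_nonneg.mpr (c3 _ d1 ?_), ?_⟩
          · rw [← d2]; exact ev_le (cnt_nonneg _) (one_le_cnt hP hb')
          · rw [cnt_erase hP, if_pos hb'] at d2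
            rw [Eo_sub, eq_sub_of_add_eq d2]; abel
        · rw [Function.update_of_ne hkb, he' k hkb]
          refine ⟨d1, ?_⟩
          rw [cnt_erase hP, if_neg (by omega), add_zero] at d2
          exact d2
      have T2 : ∀ φ' : ι → ℕ, φ' P = b → Valid p m D (R.erase P) e' φ' → Valid p m D R e φ' := by
        rintro φ' hb' ⟨Y, hY⟩
        refine ⟨Function.update Y b (Y b + χ), ?_, ?_⟩
        · intro u hu
          by_cases huP : u = P
          · rw [huP, hb']; exact hb.le
          · exact hY.1 u (Finset.mem_erase.mpr ⟨huP, hu⟩)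
        intro k hk
        obtain ⟨d1, d2⟩ := hY.2 k hk
        rw [cnt_erase hP, d2]
        by_cases hkb : k = b
        · subst hkb
          rw [Function.update_self, he'b, if_pos hb']
          refine ⟨add_nonneg d1 c0, ?_⟩
          rw [Eo_add]; abel
        · rw [Function.update_of_ne hkb, he' k hkb, if_neg (by omega), add_zero]
          exact ⟨d1, rfl⟩
      have hsl : slack m D (R.erase P) e' = slack m D R e - Eo p χ := by
        rw [slack, slack, vec_erase hP]
        have hbm := Finset.mem_range.mpr hb
        rw [← Finset.sum_erase_add _ _ hbm, ← Finset.sum_erase_add _ e hbm, he'b]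
        have : ∑ x ∈ (Finset.range D).erase b, e' x = ∑ x ∈ (Finset.range D).erase b, e x :=
          Finset.sum_congr rfl fun x hx => he' x (Finset.ne_of_mem_erase hx)
        rw [this]; abel
      have hA : ∀ k l, Acc p (slack m D (R.erase P) e') (e' k) l →
          Acc p (slack m D R e) (e k) l := by
        rintro k l ⟨Z, z, z0, z1, z2, z3⟩
        rw [hsl, le_sub_iff_add_le, ← Eo_add] at z2
        by_cases hk : k = b
        · subst hk
          refine ⟨Z + χ, z + χ, add_nonneg z0 c0, add_le_add_left z1 χ, z2, z3.trans ?_⟩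
          rw [he'b, Eo_add]
          intro x
          have := ev_nonneg ((m P : ℕ) : ZMod f) x
          simp only [Pi.add_apply, Pi.sub_apply, Pi.zero_apply] at *
          linarith
        · rw [he' k hk] at z3
          exact ⟨Z + χ, z, z0, le_add_of_le_of_nonneg z1 c0, z2, z3⟩
      have hInv' : Inv p m D (R.erase P) e' := by
        refine ⟨?_, ?_⟩
        · intro k hk
          by_cases hkb : k = b
          · rw [hkb, he'b]; exact sub_nonneg.mpr c2
          · rw [he' k hkb]; exact hInv.1 k hk
        · intro b1 b2 hlt hb2D l hl
          have hl1 := hA b1 l hl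
          have h1 := hInv.2 b1 b2 hlt hb2D l hl1
          by_cases hkb : b2 = b
          · rw [hkb] at h1 hlt
            rw [hkb, he'b]
            obtain ⟨Y0, y, hy0, hyY, hY0, hy⟩ := id hacc
            have hχY : χ ≤ Y0 := (c3 y hy0 hy).trans hyY
            have hcz := chi_zero (e b) χ _ c0 c1 c2 c3
              (fun x => Acc p (slack m D R e) (e b1) x)
              (fun x hx hx1 => Acc_pred hp (hInv.1 b1 (hlt.trans hb)) hx hY0 (hx1.trans (hχY x)))
              (hn b1 hlt) (fun x hx => hInv.2 b1 b hlt hb x hx) l hl1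
            have hne : l ≠ ((m P : ℕ) : ZMod f) := fun h => hn b1 hlt (h ▸ hl1)
            simp only [Pi.add_apply, Pi.sub_apply, Eo, ev, if_neg hne, hcz.1, hcz.2]
            linarith
          · rw [he' b2 hkb]; exact h1
      have := ih (R.erase P) e' φ1 ψ1 hcard hInv' (Mult_erase hm P)
        (NI_erase hP hφb (T1 φ1 hφb) T2 hφ1) (NI_erase hP hψb (T1 ψ1 hψb) T2 hψ1) j
      rw [Bs_erase hP, Bs_erase (φ := ψ1) hP, this, hφb, hψb]
    · push Not at hex
      have hD : ∀ φ' : ι → ℕ, Valid p m D R e φ' → φ' P = D := by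
        rintro φ' ⟨Y, hY⟩
        by_contra hne
        have hlt : φ' P < D := lt_of_le_of_ne (hY.1 P hP) hne
        exact hex _ hlt (Acc_of_mem hY hP rfl hlt)
      have hφD := hD φ hφ.1
      have hψD := hD ψ hψ.1
      have T1 : ∀ φ' : ι → ℕ, φ' P = D → Valid p m D R e φ' → Valid p m D (R.erase P) e φ' := by
        rintro φ' hb' ⟨Y, hY⟩
        refine ⟨Y, fun u hu => hY.1 u (Finset.mem_of_mem_erase hu), ?_⟩
        intro k hk
        obtain ⟨d1, d2⟩ := hY.2 k hk
        rw [cnt_erase hP, if_neg (by omega), add_zero] at d2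
        exact ⟨d1, d2⟩
      have T2 : ∀ φ' : ι → ℕ, φ' P = D → Valid p m D (R.erase P) e φ' → Valid p m D R e φ' := by
        rintro φ' hb' ⟨Y, hY⟩
        refine ⟨Y, ?_, ?_⟩
        · intro u hu
          by_cases huP : u = P
          · rw [huP, hb']
          · exact hY.1 u (Finset.mem_erase.mpr ⟨huP, hu⟩)
        intro k hk
        rw [cnt_erase hP, if_neg (by omega), add_zero]
        exact hY.2 k hk
      have hsl : slack m D (R.erase P) e ≤ slack m D R e := by
        rw [slack, slack]
        exact sub_le_sub_right (vec_mono (Finset.erase_subset P R)) _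
      have hInv' : Inv p m D (R.erase P) e := by
        refine ⟨hInv.1, ?_⟩
        rintro b1 b2 hlt hb2D l ⟨Z, z, z0, z1, z2, z3⟩
        exact hInv.2 b1 b2 hlt hb2D l ⟨Z, z, z0, z1, z2.trans hsl, z3⟩
      have := ih (R.erase P) e φ ψ hcard hInv' (Mult_erase hm P)
        (NI_erase hP hφD (T1 φ hφD) T2 hφ) (NI_erase hP hψD (T1 ψ hψD) T2 hψ) j
      rw [Bs_erase hP, Bs_erase (φ := ψ) hP, this, hφD, hψD]

end units
end Sheats

namespace Sheats
set_option linter.unusedSectionVars false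

section evenness
variable {ι : Type*} [DecidableEq ι] {f p : ℕ} {m : ι → ℕ}

/-- Powers of `p` modulo `q - 1`, indexed by classes. -/
def gg (p f : ℕ) (l : ZMod f) : ZMod (p ^ f - 1) := (p : ZMod (p ^ f - 1)) ^ l.val

lemma pf_one (hp : 2 ≤ p) : (p : ZMod (p ^ f - 1)) ^ f = 1 := by
  have h : 1 ≤ p ^ f := Nat.one_le_pow _ _ (by omega)
  have : ((p ^ f - 1 + 1 : ℕ) : ZMod (p ^ f - 1)) = 1 := by
    rw [Nat.cast_add, ZMod.natCast_self]; simp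
  rw [Nat.sub_add_cancel h] at this
  exact_mod_cast this

lemma gg_nat (hp : 2 ≤ p) (n : ℕ) : gg p f (n : ZMod f) = (p : ZMod (p ^ f - 1)) ^ n := by
  rw [gg, ZMod.val_natCast]
  conv_rhs => rw [← Nat.mod_add_div n f, pow_add, pow_mul, pf_one hp, one_pow, mul_one]

lemma gg_add [NeZero f] (hp : 2 ≤ p) (a b : ZMod f) : gg p f (a + b) = gg p f a * gg p f b := by
  have : a + b = ((a.val + b.val : ℕ) : ZMod f) := by push_cast; simp
  rw [this, gg_nat hp, pow_add]; rfl

lemma gg_one [NeZero f] (hp : 2 ≤ p) (a : ZMod f) : gg p f (a + 1) = p * gg p f a := by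
  have := gg_nat (f := f) hp 1
  rw [gg_add hp, mul_comm]
  congr 1
  simpa using this

lemma cast_sum [NeZero f] (hp : 2 ≤ p) (Q : Finset ι) :
    ((∑ u ∈ Q, p ^ m u : ℕ) : ZMod (p ^ f - 1)) =
      ∑ l : ZMod f, ((vec f m Q l : ℤ) : ZMod (p ^ f - 1)) * gg p f l := by
  simp only [vec, Finset.sum_apply, Int.cast_sum, Finset.sum_mul]
  rw [Finset.sum_comm]
  push_cast
  refine Finset.sum_congr rfl fun u _ => ?_
  rw [← gg_nat hp]
  simp [ev]

lemma even_iff [NeZero f] (hp : 2 ≤ p) (Q : Finset ι) :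
    (0 < ∑ u ∈ Q, p ^ m u ∧ (p ^ f - 1) ∣ ∑ u ∈ Q, p ^ m u) ↔
      ∃ Y : ZMod f → ℤ, 0 ≤ Y ∧ vec f m Q = (fun _ => (p : ℤ) - 1) + Eo p Y := by
  have hpz : (2 : ℤ) ≤ p := by exact_mod_cast hp
  have hf : f ≠ 0 := NeZero.ne f
  have hq1 : p ≤ p ^ f := Nat.le_self_pow hf p
  have hqz : ((p ^ f - 1 : ℕ) : ℤ) = (p : ℤ) ^ f - 1 := by
    rw [Nat.cast_sub (by omega)]; push_cast; ring
  have hqpos : (0 : ℤ) < (p : ℤ) ^ f - 1 := by rw [← hqz]; exact_mod_cast (by omega)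
  constructor
  · rintro ⟨hpos, hdvd⟩
    have h0 := (ZMod.natCast_eq_zero_iff _ _).mpr hdvd
    rw [cast_sum hp] at h0
    set c := vec f m Q with hc
    have hc0 : 0 ≤ c := vec_nonneg Q
    let T : ZMod f → ℤ := fun i => ∑ l : ZMod f, c l * (p : ℤ) ^ (l - i).val
    have hTd : ∀ i, ((p : ℤ) ^ f - 1) ∣ T i := by
      intro i
      rw [← hqz, ← ZMod.intCast_zmod_eq_zero_iff_dvd]
      simp only [T]
      push_cast
      have : ∀ l : ZMod f, ((c l : ℤ) : ZMod (p ^ f - 1)) * (p : ZMod (p ^ f - 1)) ^ (l - i).val =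
          (((c l : ℤ) : ZMod (p ^ f - 1)) * gg p f l) * gg p f (-i) := by
        intro l
        rw [mul_assoc, ← gg_add hp, ← sub_eq_add_neg]; rfl
      rw [Finset.sum_congr rfl fun l _ => this l, ← Finset.sum_mul, h0, zero_mul]
    have hTr : ∀ i, (p : ℤ) * T (i + 1) = T i + ((p : ℤ) ^ f - 1) * c i := by
      intro i
      simp only [T]
      have : ((p : ℤ) ^ f - 1) * c i = ∑ l : ZMod f, if l = i then ((p : ℤ) ^ f - 1) * c l else 0 := by
        simp
      rw [this, Finset.mul_sum, ← Finset.sum_add_distrib]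
      refine Finset.sum_congr rfl fun l _ => ?_
      by_cases hl : l = i
      · subst hl
        rw [if_pos rfl]
        have e1 : (l - (l + 1)).val + 1 = f := by
          have : l - (l + 1) = -1 := by ring
          rw [this]
          obtain ⟨k, rfl⟩ := Nat.exists_eq_succ_of_ne_zero hf
          rw [ZMod.val_neg_one]
        have : (p : ℤ) * (c l * (p : ℤ) ^ (l - (l + 1)).val) = c l * (p : ℤ) ^ f := by
          conv_rhs => rw [← e1]
          ring
        rw [this]; simp; ring
      · rw [if_neg hl, add_zero]
        have hne : l - i ≠ 0 := sub_ne_zero.mpr hl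
        have e1 : (l - i).val = (l - (i + 1)).val + 1 := by
          have h1 : l - (i + 1) = (((l - i).val - 1 : ℕ) : ZMod f) := by
            have : 1 ≤ (l - i).val := Nat.one_le_iff_ne_zero.mpr ((ZMod.val_ne_zero _).mpr hne)
            rw [Nat.cast_sub this]; simp; ring
          have h2 := ZMod.val_lt (l - i)
          have h3 : 1 ≤ (l - i).val := Nat.one_le_iff_ne_zero.mpr ((ZMod.val_ne_zero _).mpr hne)
          rw [h1, ZMod.val_natCast, Nat.mod_eq_of_lt (by omega)]; omega
        rw [e1]; ring
    obtain ⟨u, hu⟩ : Q.Nonempty := by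
      rw [Finset.nonempty_iff_ne_empty]; rintro rfl; simp at hpos
    have hTpos : ∀ i, 0 < T i := by
      intro i
      apply Finset.sum_pos'
      · intro l _
        exact mul_nonneg (hc0 l) (by positivity)
      · refine ⟨((m u : ℕ) : ZMod f), Finset.mem_univ _, ?_⟩
        have : 0 < c ((m u : ℕ) : ZMod f) := by
          rw [hc, vec_apply]
          exact_mod_cast Finset.card_pos.mpr ⟨u, by simp [hu]⟩
        positivity
    choose Z hZ using hTd
    have hZpos : ∀ i, 1 ≤ Z i := by
      intro i
      have := hTpos i
      rw [hZ i] at this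
      have := pos_of_mul_pos_right this hqpos.le
      omega
    refine ⟨fun i => Z i - 1, fun i => by have := hZpos i; simp; omega, ?_⟩
    funext i
    simp only [Pi.add_apply, Eo]
    have h1 := hTr i
    rw [hZ, hZ] at h1
    have h2 : ((p : ℤ) ^ f - 1) * (c i) = ((p : ℤ) ^ f - 1) * (p * Z (i + 1) - Z i) := by
      linear_combination -h1
    have := mul_left_cancel₀ hqpos.ne' h2
    rw [this]; ring
  · rintro ⟨Y, hY0, hY⟩
    constructor
    · apply Finset.sum_pos
      · intro u _; positivity
      · rw [Finset.nonempty_iff_ne_empty]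
        rintro rfl
        have h1 : ∑ l : ZMod f, vec f m (∅ : Finset ι) l = 0 := by simp [vec]
        rw [hY] at h1
        simp only [Pi.add_apply, Eo, Finset.sum_add_distrib, Finset.sum_sub_distrib,
          ← Finset.mul_sum] at h1
        have h2 : ∑ l : ZMod f, Y (l + 1) = ∑ l : ZMod f, Y l :=
          Equiv.sum_comp (Equiv.addRight (1 : ZMod f)) Y
        rw [h2] at h1
        have h3 : 0 ≤ ∑ l : ZMod f, Y l := Finset.sum_nonneg fun l _ => hY0 l
        simp only [Finset.sum_const, Finset.card_univ, ZMod.card, nsmul_eq_mul] at h1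
        have h4 : (1 : ℤ) ≤ f := by exact_mod_cast Nat.one_le_iff_ne_zero.mpr hf
        nlinarith
    · rw [← ZMod.natCast_eq_zero_iff, cast_sum hp, hY]
      have : ∀ l : ZMod f, (((((fun _ => (p : ℤ) - 1) + Eo p Y : ZMod f → ℤ) l) : ℤ) :
          ZMod (p ^ f - 1)) * gg p f l =
          ((Y (l + 1) + 1 : ℤ) : ZMod (p ^ f - 1)) * gg p f (l + 1) -
          ((Y l + 1 : ℤ) : ZMod (p ^ f - 1)) * gg p f l := by
        intro l
        rw [gg_one hp]
        simp only [Pi.add_apply, Eo]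
        push_cast
        ring
      rw [Finset.sum_congr rfl fun l _ => this l, Finset.sum_sub_distrib]
      exact sub_eq_zero.mpr (Equiv.sum_comp (Equiv.addRight (1 : ZMod f))
          (fun l => ((Y l + 1 : ℤ) : ZMod (p ^ f - 1)) * gg p f l))

end evenness

lemma digit_sum {p : ℕ} (hp : 2 ≤ p) (K : ℕ) : ∀ (c : ℕ → ℕ), (∀ a, c a < p) → ∀ b,
    (∑ a ∈ Finset.range K, c a * p ^ a) / p ^ b % p = if b < K then c b else 0 := by
  induction K with
  | zero => intro c _ b; simp
  | succ K ih =>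
    intro c hc b
    rw [Finset.sum_range_succ']
    have h1 : ∑ a ∈ Finset.range K, c (a + 1) * p ^ (a + 1) =
        p * ∑ a ∈ Finset.range K, c (a + 1) * p ^ a := by
      rw [Finset.mul_sum]
      exact Finset.sum_congr rfl fun a _ => by ring
    rw [h1, pow_zero, mul_one]
    cases b with
    | zero => simp [Nat.mod_eq_of_lt (hc 0)]
    | succ b =>
      rw [pow_succ', ← Nat.div_div_eq_div_mul, Nat.mul_add_div (by omega),
        Nat.div_eq_of_lt (hc 0), add_zero, ih (fun a => c (a + 1)) (fun a => hc _) b]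
      simp

lemma sum_digits {p : ℕ} (hp : 2 ≤ p) (K : ℕ) : ∀ n, n < p ^ K →
    ∑ a ∈ Finset.range K, (n / p ^ a % p) * p ^ a = n := by
  induction K with
  | zero => intro n hn; simp at hn; simp [hn]
  | succ K ih =>
    intro n hn
    rw [Finset.sum_range_succ']
    have h1 : ∑ a ∈ Finset.range K, (n / p ^ (a + 1) % p) * p ^ (a + 1) =
        p * ∑ a ∈ Finset.range K, (n / p / p ^ a % p) * p ^ a := by
      rw [Finset.mul_sum]
      refine Finset.sum_congr rfl fun a _ => ?_
      rw [Nat.div_div_eq_div_mul, ← pow_succ']; ring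
    rw [h1, ih (n / p) (by rw [Nat.div_lt_iff_lt_mul (by omega), ← pow_succ]; exact hn)]
    simp [Nat.div_add_mod]

end Sheats

namespace Sheats
set_option linter.unusedSectionVars false

/-- Units: pairs (exponent, copy number). -/
abbrev Un := (_ : ℕ) × ℕ

/-- The exponent of a unit. -/
def mm (u : Un) : ℕ := u.1

/-- All units of `N`. -/
def RR (p N : ℕ) : Finset Un :=
  (Finset.range (N + 1)).sigma fun a => Finset.range (N / p ^ a % p)

/-- Number of copies of `p ^ a` in bin `j`. -/
def nn (p N : ℕ) (φ : Un → ℕ) (a j : ℕ) : ℕ :=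
  ((Finset.range (N / p ^ a % p)).filter fun c => φ ⟨a, c⟩ = j).card

/-- Bin contents as a tuple. -/
def TT (p N d : ℕ) (φ : Un → ℕ) : Fin d → ℕ := fun j => Bs p mm (RR p N) φ j

/-- Initial need vectors. -/
def e0 (p f : ℕ) : ℕ → ZMod f → ℤ := fun _ _ => (p : ℤ) - 1

variable {p f N d : ℕ}

lemma Bs_eq (φ : Un → ℕ) (j : ℕ) :
    Bs p mm (RR p N) φ j = ∑ a ∈ Finset.range (N + 1), nn p N φ a j * p ^ a := by
  rw [Bs, RR, Finset.sum_sigma]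
  refine Finset.sum_congr rfl fun a _ => ?_
  simp only [mm]
  rw [← Finset.sum_filter, Finset.sum_const, smul_eq_mul]
  rfl

lemma nn_lt (hp : 2 ≤ p) (φ : Un → ℕ) (a j : ℕ) : nn p N φ a j < p := by
  refine lt_of_le_of_lt (Finset.card_filter_le _ _) ?_
  rw [Finset.card_range]
  exact Nat.mod_lt _ (by omega)

lemma N_lt (hp : 2 ≤ p) : N < p ^ (N + 1) :=
  lt_of_lt_of_le (Nat.lt_succ_self N) (Nat.lt_pow_self (by omega)).le

lemma digit_Bs (hp : 2 ≤ p) (φ : Un → ℕ) (j a : ℕ) :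
    Bs p mm (RR p N) φ j / p ^ a % p = if a < N + 1 then nn p N φ a j else 0 := by
  rw [Bs_eq, digit_sum hp (N + 1) (fun a => nn p N φ a j) (fun a => nn_lt hp φ a j)]

lemma digit_N (hp : 2 ≤ p) {a : ℕ} (ha : ¬ a < N + 1) : N / p ^ a % p = 0 := by
  have : N < p ^ a := lt_of_lt_of_le (N_lt hp) (Nat.pow_le_pow_right (by omega) (by omega))
  rw [Nat.div_eq_of_lt this, Nat.zero_mod]

lemma sum_nn (hd : 0 < d) {φ : Un → ℕ} (hφ : ∀ u ∈ RR p N, φ u ≤ d - 1) {a : ℕ}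
    (ha : a < N + 1) : ∑ j : Fin d, nn p N φ a j = N / p ^ a % p := by
  rw [Fin.sum_univ_eq_sum_range (fun j => nn p N φ a j) d]
  unfold nn
  rw [← Finset.card_eq_sum_card_fiberwise, Finset.card_range]
  intro c hc
  have := hφ ⟨a, c⟩ (Finset.mem_sigma.mpr ⟨Finset.mem_range.mpr ha, hc⟩)
  simp only [Finset.coe_range, Set.mem_Iio]
  omega

lemma T_mem (hp : 2 ≤ p) [NeZero f] (hd : 0 < d) {φ : Un → ℕ}
    (h : Valid p mm (d - 1) (RR p N) (e0 p f) φ) : TT p N d φ ∈ Wset p (p ^ f) d N := by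
  obtain ⟨Y, hY⟩ := h
  refine ⟨⟨?_, ?_⟩, ?_⟩
  · simp only [TT, Bs_eq]
    rw [Finset.sum_comm]
    refine (Finset.sum_congr rfl fun a ha => ?_).trans (sum_digits hp (N + 1) N (N_lt hp))
    rw [← Finset.sum_mul, sum_nn hd hY.1 (Finset.mem_range.mp ha)]
  · intro a
    simp only [TT, digit_Bs hp]
    by_cases ha : a < N + 1
    · simp only [if_pos ha]
      exact sum_nn hd hY.1 ha
    · simp only [if_neg ha, digit_N hp ha, Finset.sum_const_zero]
  · intro i hi
    have := hY.2 i (by omega)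
    simp only [TT, Bs]
    rw [← Finset.sum_filter]
    exact (even_iff hp _).mpr ⟨Y i, this⟩

lemma exists_phi (hp : 2 ≤ p) [NeZero f] (hd : 0 < d) {X : Fin d → ℕ}
    (hX : X ∈ Wset p (p ^ f) d N) :
    ∃ φ, Valid p mm (d - 1) (RR p N) (e0 p f) φ ∧ TT p N d φ = X := by
  obtain ⟨⟨hs, hdig⟩, hev⟩ := hX
  let x : ℕ → ℕ := fun j => if h : j < d then X ⟨j, h⟩ else 0
  have hx : ∀ j : Fin d, x j = X j := fun j => by simp [x]
  let S : ℕ → ℕ → ℕ := fun a j => ∑ i ∈ Finset.range j, x i / p ^ a % p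
  have hSd : ∀ a, S a d = N / p ^ a % p := by
    intro a
    rw [← hdig a]
    simp only [S]
    rw [← Fin.sum_univ_eq_sum_range (fun i => x i / p ^ a % p) d]
    exact Finset.sum_congr rfl fun j _ => by rw [hx]
  have hSmono : ∀ a, Monotone (S a) := by
    intro a i j hij
    exact Finset.sum_le_sum_of_subset (Finset.range_subset_range.mpr hij)
  let φ : Un → ℕ := fun u => Nat.findGreatest (fun j => S u.1 j ≤ u.2) (d - 1)
  have hle : ∀ u, φ u ≤ d - 1 := fun u => Nat.findGreatest_le _
  have hφ : ∀ a c j, j < d → c < S a d → (φ ⟨a, c⟩ = j ↔ S a j ≤ c ∧ c < S a (j + 1)) := by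
    intro a c j hj hc
    simp only [φ]
    rw [Nat.findGreatest_eq_iff]
    constructor
    · rintro ⟨h1, h2, h3⟩
      refine ⟨?_, ?_⟩
      · rcases Nat.eq_zero_or_pos j with h | h
        · rw [h]; simp [S]
        · exact h2 (by omega)
      · by_cases hjd : j = d - 1
        · rw [hjd, Nat.sub_add_cancel hd]; exact hc
        · exact not_le.mp (h3 (Nat.lt_succ_self j) (by omega))
    · rintro ⟨h1, h2⟩
      refine ⟨by omega, fun _ => h1, fun n hn _ => ?_⟩
      have := hSmono a (show j + 1 ≤ n by omega)
      omega
  have hnn : ∀ a j, j < d → nn p N φ a j = x j / p ^ a % p := by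
    intro a j hj
    have : ((Finset.range (N / p ^ a % p)).filter fun c => φ ⟨a, c⟩ = j) =
        Finset.Ico (S a j) (S a (j + 1)) := by
      ext c
      rw [Finset.mem_filter, Finset.mem_range, Finset.mem_Ico, ← hSd]
      constructor
      · rintro ⟨h1, h2⟩; exact (hφ a c j hj h1).mp h2
      · intro h
        have h1 : c < S a d := lt_of_lt_of_le h.2 (hSmono a (by omega))
        exact ⟨h1, (hφ a c j hj h1).mpr h⟩
    rw [nn, this, Nat.card_Ico]
    simp only [S, Finset.sum_range_succ]
    omega
  have hT : TT p N d φ = X := by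
    funext j
    rw [TT, Bs_eq, ← hx]
    rw [Finset.sum_congr rfl fun a _ => by rw [hnn a j j.2]]
    apply sum_digits hp
    refine lt_of_le_of_lt ?_ (N_lt hp)
    rw [hx, ← hs]
    exact Finset.single_le_sum (fun _ _ => Nat.zero_le _) (Finset.mem_univ j)
  have hY : ∀ j, ∃ Y : ZMod f → ℤ, j < d - 1 → 0 ≤ Y ∧
      cnt f mm (RR p N) φ j = e0 p f j + Eo p Y := by
    intro j
    by_cases hj : j < d - 1
    · have h1 := hev ⟨j, by omega⟩ (by simp only; omega)
      rw [← hT] at h1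
      simp only [TT, Bs] at h1
      rw [← Finset.sum_filter] at h1
      obtain ⟨Y, h2, h3⟩ := (even_iff hp _).mp h1
      exact ⟨Y, fun _ => ⟨h2, h3⟩⟩
    · exact ⟨0, fun h => absurd h hj⟩
  choose Y hY using hY
  exact ⟨φ, ⟨Y, fun u _ => hle u, hY⟩, hT⟩

lemma wt_eq (hd : 0 < d) {φ : Un → ℕ} (hφ : ∀ u ∈ RR p N, φ u ≤ d - 1) :
    wtW (TT p N d φ) = wgt p mm (RR p N) φ + ∑ u ∈ RR p N, p ^ mm u := by
  rw [wtW, wgt, ← Finset.sum_add_distrib]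
  simp only [TT, Bs]
  rw [Fin.sum_univ_eq_sum_range
    (fun j => (j + 1) * ∑ u ∈ RR p N, if φ u = j then p ^ mm u else 0) d]
  simp only [Finset.mul_sum]
  rw [Finset.sum_comm]
  refine Finset.sum_congr rfl fun u hu => ?_
  have h1 : φ u ∈ Finset.range d := Finset.mem_range.mpr (by have := hφ u hu; omega)
  rw [Finset.sum_eq_single_of_mem (φ u) h1]
  · rw [if_pos rfl]; ring
  · intro j _ hj
    rw [if_neg (Ne.symm hj), mul_zero]

lemma better_T (hd : 0 < d) {φ φ' : Un → ℕ} (hφ : ∀ u ∈ RR p N, φ u ≤ d - 1)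
    (hφ' : ∀ u ∈ RR p N, φ' u ≤ d - 1) (h : Better p mm (RR p N) φ φ') :
    LexLT (TT p N d φ) (TT p N d φ') ∧ wtW (TT p N d φ') < wtW (TT p N d φ) := by
  obtain ⟨⟨b, h1, h2⟩, h3⟩ := h
  constructor
  · have hb : b < d := by
      by_contra hb
      have : Bs p mm (RR p N) φ' b = 0 := by
        apply Finset.sum_eq_zero
        intro u hu
        have := hφ' u hu
        rw [if_neg (by omega)]
      omega
    exact ⟨⟨b, hb⟩, fun j hj => (h1 j hj).symm, h2⟩
  · rw [wt_eq hd hφ, wt_eq hd hφ']; omega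

lemma lex_asymm {x y : Fin d → ℕ} (h : LexLT x y) (h' : LexLE y x) : False := by
  obtain ⟨i, hi1, hi2⟩ := h
  rcases h' with rfl | ⟨k, hk1, hk2⟩
  · exact lt_irrefl _ hi2
  · rcases lt_trichotomy i k with h | h | h
    · have := hk1 i h; omega
    · subst h; omega
    · have := hi1 k h; omega

lemma Mult_RR (hp : 2 ≤ p) : Mult p mm (RR p N) := by
  intro a
  have : (RR p N).filter (fun u => mm u = a) ⊆
      (Finset.range (N / p ^ a % p)).image (fun c => (⟨a, c⟩ : Un)) := by
    rintro ⟨a', c⟩ hu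
    have h1 := Finset.mem_filter.mp hu
    have h2 := Finset.mem_sigma.mp h1.1
    have h3 : a' = a := h1.2
    subst h3
    exact Finset.mem_image.mpr ⟨c, h2.2, rfl⟩
  refine lt_of_le_of_lt ((Finset.card_le_card this).trans Finset.card_image_le) ?_
  rw [Finset.card_range]
  exact Nat.mod_lt _ (by omega)

lemma Inv_RR (hp : 2 ≤ p) (D : ℕ) : Inv p mm D (RR p N) (e0 p f) := by
  have hpz : (2 : ℤ) ≤ p := by exact_mod_cast hp
  refine ⟨fun j _ l => ?_, fun _ _ _ _ l _ => ?_⟩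
  · simp only [e0, Pi.zero_apply]; omega
  · simp only [e0]; omega

end Sheats

open Sheats

/-- main theorem: the modest composition of `W_d(N)` has weight strictly
smaller than every other element of `W_d(N)`; in particular it is the unique optimal one. -/
theorem modest_unique_optimal
    (p f : ℕ) (hp : p.Prime) (hf : 0 < f) (N d : ℕ) (hN : 0 < N) (hd : 0 < d)
    (M : Fin d → ℕ) (hM : Modest p (p ^ f) N M) :
    ∀ Y ∈ Wset p (p ^ f) d N, Y ≠ M → wtW M < wtW Y := by
  have hp2 := hp.two_le
  have : NeZero f := ⟨hf.ne'⟩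
  obtain ⟨φM, hVM, hTM⟩ := exists_phi hp2 hd hM.1
  have hNIM : NI p mm (d - 1) (RR p N) (e0 p f) φM := by
    refine ⟨hVM, fun φ' hV' hB => ?_⟩
    obtain ⟨_, h1⟩ := id hVM
    obtain ⟨_, h2⟩ := id hV'
    have := (better_T hd h1.1 h2.1 hB).1
    rw [hTM] at this
    exact lex_asymm this (hM.2 _ (T_mem hp2 hd hV'))
  have key : ∀ n, ∀ φ, wgt p mm (RR p N) φ = n → Valid p mm (d - 1) (RR p N) (e0 p f) φ →
      TT p N d φ ≠ M → wtW M < wtW (TT p N d φ) := by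
    intro n
    induction n using Nat.strong_induction_on with
    | _ n ih =>
      intro φ hn hV hne
      by_cases hNI : NI p mm (d - 1) (RR p N) (e0 p f) φ
      · exfalso
        apply hne
        rw [← hTM]
        funext j
        exact core hp2 _ (RR p N) (e0 p f) φ φM rfl (Inv_RR hp2 _) (Mult_RR hp2) hNI hNIM j
      · have : ∃ φ', Valid p mm (d - 1) (RR p N) (e0 p f) φ' ∧ Better p mm (RR p N) φ φ' := by
          by_contra hno
          push Not at hno
          exact hNI ⟨hV, hno⟩
        obtain ⟨φ', hV', hB⟩ := this
        obtain ⟨_, h1⟩ := id hV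
        obtain ⟨_, h2⟩ := id hV'
        have hlt := (better_T hd h1.1 h2.1 hB).2
        by_cases hT : TT p N d φ' = M
        · rw [hT] at hlt; exact hlt
        · exact (ih _ (hn ▸ hB.2) φ' rfl hV' hT).trans hlt
  intro X hX hne
  obtain ⟨φ, hV, hT⟩ := exists_phi hp2 hd hX
  rw [← hT] at hne ⊢
  exact key _ φ rfl hV hne
end

section
/- Let N have base-p expansion N = Σ_{i=0}^n a_i p^i with a_n ≠ 0, suppose W_d(N) ≠ ∅, and let X = (X_1, …, X_d) ∈ W_d(N) be modest or optimal. Then: (i) X_1 ≥ a_n·p^n, and in particular X_1 > N/2; (ii) N ≤ wt(X) < 2N; (iii) if d ≥ 2, then W_d(N − X_1) = ∅. -/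
open Polynomial

/-- digit -/
def dg (p x k : ℕ) : ℕ := x / p ^ k % p

lemma dg_add {p : ℕ} (hp : 1 < p) (k : ℕ) : ∀ a b : ℕ, (∀ k, dg p a k + dg p b k < p) →
    dg p (a + b) k = dg p a k + dg p b k := by
  induction k with
  | zero =>
    intro a b h
    have := h 0
    simp only [dg, pow_zero, Nat.div_one] at *
    rw [Nat.add_mod, Nat.mod_eq_of_lt this]
  | succ k ih =>
    intro a b h
    have h0 := h 0
    have hs : ∀ x j, dg p x (j+1) = dg p (x / p) j := by
      intro x j
      simp only [dg]
      rw [pow_succ', Nat.div_div_eq_div_mul]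
    have e : (a + b) / p = a / p + b / p := by
      simp only [dg, pow_zero, Nat.div_one] at h0
      rw [Nat.add_div (by omega), if_neg (by omega)]; rfl
    rw [hs, hs, hs, e]
    apply ih
    intro j
    rw [← hs, ← hs]
    exact h _

lemma dg_zero (p k : ℕ) : dg p 0 k = 0 := by simp [dg]

lemma dg_lt {p : ℕ} (hp : 1 < p) (x k : ℕ) : dg p x k < p := Nat.mod_lt _ (by omega)

lemma dg_sum {ι : Type*} {p : ℕ} (hp : 1 < p) (Y : ι → ℕ) (s : Finset ι) :
    (∀ k, ∑ i ∈ s, dg p (Y i) k < p) → ∀ k, dg p (∑ i ∈ s, Y i) k = ∑ i ∈ s, dg p (Y i) k := by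
  classical
  induction s using Finset.induction_on with
  | empty => intro _ k; simp [dg_zero]
  | insert a s ha ih =>
    intro h k
    simp only [Finset.sum_insert ha] at *
    have ih' := ih (fun k => lt_of_le_of_lt (Nat.le_add_left _ _) (h k))
    rw [dg_add hp, ih']
    intro k
    rw [ih']
    exact h k

lemma dg_mul_pow {p : ℕ} (hp : 1 < p) (c m k : ℕ) (hc : c < p) :
    dg p (c * p ^ m) k = if k = m then c else 0 := by
  have hp0 : 0 < p := by omega
  unfold dg
  rcases lt_trichotomy k m with h | h | h
  · obtain ⟨t, rfl⟩ := Nat.exists_eq_add_of_lt h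
    rw [if_neg (by omega)]
    have : c * p ^ (k + t + 1) = (c * p ^ t * p) * p ^ k := by ring
    rw [this, Nat.mul_div_cancel _ (by positivity)]
    simp
  · subst h
    rw [Nat.mul_div_cancel _ (by positivity), if_pos rfl, Nat.mod_eq_of_lt hc]
  · rw [if_neg (by omega), Nat.div_eq_of_lt]
    · simp
    · calc c * p ^ m < p * p ^ m := by gcongr
        _ = p ^ (m+1) := by ring
        _ ≤ p ^ k := Nat.pow_le_pow_right hp0 h

lemma dg_val {p : ℕ} (hp : 1 < p) (c : ℕ → ℕ) (hc : ∀ k, c k < p) (m k : ℕ) :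
    dg p (∑ j ∈ Finset.range m, c j * p ^ j) k = if k < m then c k else 0 := by
  have key : ∀ k, ∑ j ∈ Finset.range m, dg p (c j * p ^ j) k = if k < m then c k else 0 := by
    intro k
    simp only [dg_mul_pow hp _ _ _ (hc _)]
    simp
  rw [dg_sum hp, key]
  intro k
  rw [key]
  split_ifs
  · exact hc k
  · omega

lemma mod_eq_val {p : ℕ} (x m : ℕ) :
    x % p ^ m = ∑ j ∈ Finset.range m, dg p x j * p ^ j := by
  induction m with
  | zero => simp [Nat.mod_one]
  | succ m ih => rw [Finset.sum_range_succ, ← ih, dg, pow_succ, Nat.mod_mul]; ring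

lemma eq_val {p : ℕ} (x m : ℕ) (h : x < p ^ m) :
    x = ∑ j ∈ Finset.range m, dg p x j * p ^ j := by
  rw [← mod_eq_val, Nat.mod_eq_of_lt h]

lemma dg_eq_zero {p : ℕ} (hp : 1 < p) (x m k : ℕ) (h : x < p ^ m) (hk : m ≤ k) :
    dg p x k = 0 := by
  unfold dg
  rw [Nat.div_eq_of_lt]
  · simp
  · exact lt_of_lt_of_le h (Nat.pow_le_pow_right (by omega) hk)

lemma dg_split {p : ℕ} (hp : 1 < p) (a m : ℕ) (ha : a < p ^ m) (c : ℕ → ℕ)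
    (hc : ∀ k, c k ≤ dg p a k) :
    ∃ R, a = (∑ j ∈ Finset.range m, c j * p ^ j) + R ∧
      ∀ k, dg p a k = c k + dg p R k := by
  refine ⟨∑ j ∈ Finset.range m, (dg p a j - c j) * p ^ j, ?_, ?_⟩
  · rw [← Finset.sum_add_distrib]
    conv_lhs => rw [eq_val a m ha]
    apply Finset.sum_congr rfl
    intro j _
    rw [← add_mul, Nat.add_sub_cancel' (hc j)]
  · intro k
    rw [dg_val hp]
    · have := hc k
      split_ifs with h
      · omega
      · have := dg_eq_zero hp a m k ha (by omega)
        omega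
    · intro k
      exact lt_of_le_of_lt (Nat.sub_le _ _) (dg_lt hp _ _)

/-- Subset sums of powers hit the target. -/
lemma greedy {p : ℕ} (hp : 1 < p) (s : Finset ℕ) (g : ℕ → ℕ) (F : ℕ) (hg : ∀ i, g i ≤ F) :
    ∀ (n : ℕ) (c : ℕ → ℕ), ∑ i ∈ s, c i * p ^ g i = n → p ^ F ≤ n →
      ∃ c' : ℕ → ℕ, (∀ i, c' i ≤ c i) ∧ ∑ i ∈ s, c' i * p ^ g i = p ^ F := by
  intro n
  induction n using Nat.strong_induction_on with
  | _ n ih =>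
  intro c hc hn
  rcases hn.eq_or_lt with h | h
  · exact ⟨c, fun _ => le_rfl, by rw [hc, h]⟩
  have hne : (s.filter (fun i => 0 < c i)).Nonempty := by
    by_contra hcon
    rw [Finset.not_nonempty_iff_eq_empty, Finset.filter_eq_empty_iff] at hcon
    have : ∑ i ∈ s, c i * p ^ g i = 0 := by
      apply Finset.sum_eq_zero
      intro i hi
      have := hcon hi
      have : c i = 0 := by omega
      simp [this]
    omega
  obtain ⟨i, hi, hmin⟩ := Finset.exists_min_image _ g hne
  rw [Finset.mem_filter] at hi
  have hd1 : p ^ g i ∣ n := by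
    rw [← hc]
    apply Finset.dvd_sum
    intro j hj
    by_cases h0 : 0 < c j
    · exact Dvd.dvd.mul_left (pow_dvd_pow _ (hmin j (by simp [hj, h0]))) _
    · have : c j = 0 := by omega
      simp [this]
  have hd2 : p ^ g i ∣ p ^ F := pow_dvd_pow _ (hg i)
  have hd3 : p ^ g i ≤ n - p ^ F := Nat.le_of_dvd (by omega) (Nat.dvd_sub hd1 hd2)
  have hpos : 0 < p ^ g i := by positivity
  have hsum : ∑ j ∈ s, (Function.update c i (c i - 1)) j * p ^ g j + p ^ g i = n := by
    rw [← hc, ← Finset.add_sum_erase s _ hi.1, ← Finset.add_sum_erase s (fun j => c j * p ^ g j) hi.1]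
    have : ∑ x ∈ s.erase i, Function.update c i (c i - 1) x * p ^ g x
        = ∑ x ∈ s.erase i, c x * p ^ g x := by
      apply Finset.sum_congr rfl
      intro x hx
      rw [Function.update_of_ne (Finset.ne_of_mem_erase hx)]
    rw [this]
    simp only [Function.update_self]
    obtain ⟨t, ht⟩ : ∃ t, c i = t + 1 := ⟨c i - 1, by omega⟩
    rw [ht]
    simp
    ring
  obtain ⟨c', h1, h2⟩ := ih (n - p ^ g i) (by omega) (Function.update c i (c i - 1)) (by omega) (by omega)
  refine ⟨c', fun j => (h1 j).trans ?_, h2⟩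
  by_cases hj : j = i
  · subst hj; simp
  · rw [Function.update_of_ne hj]

lemma exists_sub (p f : ℕ) (hp : p.Prime) (hf : 0 < f) (n A : ℕ) (hA : 0 < A)
    (hdvd : (p ^ f - 1) ∣ A) (hlt : A < p ^ (n + 1)) (ha : dg p A n + 1 < p) :
    ∃ c : ℕ → ℕ, (∀ k, c k ≤ dg p A k) ∧ (∀ k, n ≤ k → c k = 0) ∧
      0 < ∑ j ∈ Finset.range n, c j * p ^ j ∧
      ∑ j ∈ Finset.range n, c j * p ^ j < p ^ n ∧
      (∑ j ∈ Finset.range n, c j * p ^ j) ≡ p ^ n [MOD p ^ f - 1] := by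
  have hp1 := hp.one_lt
  have hp0 : 0 < p := by omega
  have hqp : p ≤ p ^ f := Nat.le_self_pow (by omega) p
  set K := n * (f - 1) with hK
  have hnK : n + K = f * n := by
    obtain ⟨t, rfl⟩ : ∃ t, f = t + 1 := ⟨f - 1, by omega⟩
    simp [hK]; ring
  set g : ℕ → ℕ := fun k => (k + K) % f with hgdef
  have hq1 : p ^ f ≡ 1 [MOD p ^ f - 1] := by
    have : p ^ f = 1 + (p ^ f - 1) := by omega
    conv_lhs => rw [this]
    simp
  have hgm : ∀ k, p ^ g k ≡ p ^ (k + K) [MOD p ^ f - 1] := by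
    intro k
    conv_rhs => rw [← Nat.div_add_mod (k + K) f, pow_add, pow_mul]
    have := (hq1.pow ((k + K) / f)).mul_right (p ^ ((k + K) % f))
    simp only [one_pow, one_mul] at this
    exact this.symm
  have hgsum : ∀ c : ℕ → ℕ, ∑ j ∈ Finset.range n, c j * p ^ g j ≡
      (∑ j ∈ Finset.range n, c j * p ^ j) * p ^ K [MOD p ^ f - 1] := by
    intro c
    rw [Finset.sum_mul]
    apply Nat.ModEq.sum
    intro j _
    rw [mul_assoc, ← pow_add]
    exact (hgm j).mul_left _
  have hnK1 : p ^ (n + K) ≡ 1 [MOD p ^ f - 1] := by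
    rw [hnK, pow_mul]
    simpa using hq1.pow n
  -- reduction
  suffices H : ∃ c : ℕ → ℕ, (∀ k, c k ≤ dg p A k) ∧
      0 < ∑ j ∈ Finset.range n, c j * p ^ g j ∧
      ∑ j ∈ Finset.range n, c j * p ^ g j ≡ 1 [MOD p ^ f - 1] by
    obtain ⟨c, h1, h2, h3⟩ := H
    have hsame : ∑ j ∈ Finset.range n, (if j < n then c j else 0) * p ^ j
        = ∑ j ∈ Finset.range n, c j * p ^ j := by
      apply Finset.sum_congr rfl
      intro j hj
      rw [if_pos (Finset.mem_range.mp hj)]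
    refine ⟨fun k => if k < n then c k else 0, ?_, ?_, ?_, ?_, ?_⟩
    · intro k
      dsimp only
      split_ifs
      · exact h1 k
      · omega
    · intro k hk
      simp; omega
    · rw [hsame]
      rw [Nat.pos_iff_ne_zero] at h2 ⊢
      intro h
      apply h2
      rw [Finset.sum_eq_zero_iff] at h ⊢
      intro i hi
      have := h i hi
      have hz : p ^ i ≠ 0 := by positivity
      have : c i = 0 := (Nat.mul_eq_zero.mp this).resolve_right hz
      simp [this]
    · rw [hsame]
      calc _ ≤ ∑ j ∈ Finset.range n, dg p A j * p ^ j := by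
            apply Finset.sum_le_sum; intro j _; gcongr; exact h1 j
        _ = A % p ^ n := (mod_eq_val _ _).symm
        _ < p ^ n := Nat.mod_lt _ (by positivity)
    · rw [hsame]
      set S := ∑ j ∈ Finset.range n, c j * p ^ j
      have e1 : S * p ^ K * p ^ n ≡ 1 * p ^ n [MOD p ^ f - 1] :=
        ((hgsum c).symm.trans h3).mul_right _
      have e2 : S * p ^ K * p ^ n ≡ S * 1 [MOD p ^ f - 1] := by
        have : S * p ^ K * p ^ n = S * p ^ (n + K) := by ring
        rw [this]
        exact hnK1.mul_left _
      simpa using e2.symm.trans e1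
  by_cases hc0 : ∃ k < n, 0 < dg p A k ∧ g k = 0
  · obtain ⟨k, hk, hpos, hgk⟩ := hc0
    have hs : ∑ j ∈ Finset.range n, (if j = k then 1 else 0) * p ^ g j = 1 := by
      rw [Finset.sum_eq_single k]
      · simp [hgk]
      · intro b _ hb; simp [hb]
      · intro h; simp at h; omega
    refine ⟨fun j => if j = k then 1 else 0, ?_, ?_, ?_⟩
    · intro j
      dsimp only
      split_ifs with h
      · subst h; exact hpos
      · omega
    · rw [hs]; omega
    · rw [hs]
  · push Not at hc0
    set M := ∑ j ∈ Finset.range n, dg p A j * p ^ g j with hM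
    set a := dg p A n with hadef
    have hAe : A = ∑ j ∈ Finset.range n, dg p A j * p ^ j + a * p ^ n := by
      conv_lhs => rw [eq_val A (n+1) hlt]
      rw [Finset.sum_range_succ]
    have hMa : p ^ f - 1 ∣ M + a := by
      rw [← Nat.modEq_zero_iff_dvd]
      have e1 : A * p ^ K ≡ 0 [MOD p ^ f - 1] := by
        rw [Nat.modEq_zero_iff_dvd]; exact hdvd.mul_right _
      have e2 : A * p ^ K = (∑ j ∈ Finset.range n, dg p A j * p ^ j) * p ^ K + a * p ^ (n + K) := by
        conv_lhs => rw [hAe]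
        ring
      rw [e2] at e1
      have e3 : M + a * 1 ≡ (∑ j ∈ Finset.range n, dg p A j * p ^ j) * p ^ K + a * p ^ (n + K)
          [MOD p ^ f - 1] := (hgsum _).add (hnK1.symm.mul_left a)
      simpa using e3.trans e1
    have hMpos : 0 < M := by
      rw [Nat.pos_iff_ne_zero]
      intro h0
      rw [h0, zero_add] at hMa
      have ha0 : a = 0 := Nat.eq_zero_of_dvd_of_lt hMa (by omega)
      rw [hM, Finset.sum_eq_zero_iff] at h0
      have : A = 0 := by
        rw [hAe, ha0, zero_mul, add_zero]
        apply Finset.sum_eq_zero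
        intro i hi
        have := h0 i hi
        have hz : p ^ g i ≠ 0 := by positivity
        have : dg p A i = 0 := (Nat.mul_eq_zero.mp this).resolve_right hz
        simp [this]
      omega
    have hpM : p ∣ M := by
      apply Finset.dvd_sum
      intro j hj
      by_cases h0 : 0 < dg p A j
      · exact Dvd.dvd.mul_left (dvd_pow_self p (hc0 j (Finset.mem_range.mp hj) h0)) _
      · have : dg p A j = 0 := by omega
        simp [this]
    have hMq : p ^ f ≤ M := by
      obtain ⟨k, hk⟩ := hMa
      have hk0 : k ≠ 0 := by rintro rfl; simp at hk; omega
      by_cases hk1 : k = 1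
      · exfalso
        subst hk1
        have hpq : p ∣ p ^ f := dvd_pow_self p (by omega)
        have : p ∣ a + 1 := by
          have h := Nat.dvd_sub hpq hpM
          have e : p ^ f - M = a + 1 := by omega
          rwa [e] at h
        have := Nat.le_of_dvd (by omega) this
        omega
      · have : (p ^ f - 1) * 2 ≤ (p ^ f - 1) * k := by
          apply Nat.mul_le_mul_left; omega
        omega
    obtain ⟨c, h1, h2⟩ := greedy hp1 (Finset.range n) g f
      (fun i => (Nat.mod_lt _ hf).le) M (dg p A) rfl hMq
    refine ⟨c, h1, ?_, ?_⟩
    · rw [h2]; positivity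
    · rw [h2]; exact hq1

lemma noCarry_iff (p : ℕ) {n : ℕ} (m : Fin n → ℕ) (k : ℕ) :
    NoCarry p m k ↔ (∑ i, m i) = k ∧ ∀ j : ℕ, (∑ i, dg p (m i) j) = dg p k j := Iff.rfl

lemma noCarry_cons {p : ℕ} (hp : 1 < p) {d : ℕ} (Z : Fin (d + 1) → ℕ) (N : ℕ) :
    NoCarry p Z N ↔ ∃ M, N = Z 0 + M ∧ (∀ k, dg p N k = dg p (Z 0) k + dg p M k) ∧
      NoCarry p (fun i : Fin d => Z i.succ) M := by
  simp only [noCarry_iff, Fin.sum_univ_succ]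
  constructor
  · rintro ⟨h1, h2⟩
    have key := dg_sum hp (fun i : Fin d => Z i.succ) Finset.univ (fun k => by
      have := h2 k
      have := dg_lt hp N k
      omega)
    refine ⟨_, h1.symm, ?_, rfl, ?_⟩
    · intro k; rw [key, ← h2 k]
    · intro k; rw [key]
  · rintro ⟨M, h1, h2, h3, h4⟩
    refine ⟨by omega, ?_⟩
    intro k
    rw [h2, h4]

lemma wset_cons {p : ℕ} (hp : 1 < p) {q d : ℕ} (Z : Fin (d + 2) → ℕ) (N : ℕ) :
    Z ∈ Wset p q (d + 2) N ↔ 0 < Z 0 ∧ (q - 1) ∣ Z 0 ∧ ∃ M, N = Z 0 + M ∧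
      (∀ k, dg p N k = dg p (Z 0) k + dg p M k) ∧
      (fun i : Fin (d + 1) => Z i.succ) ∈ Wset p q (d + 1) M := by
  simp only [Wset, Set.mem_ofPred_eq]
  rw [noCarry_cons hp]
  constructor
  · rintro ⟨⟨M, h1, h2, h3⟩, h4⟩
    have h0 := h4 0 (by simp)
    exact ⟨h0.1, h0.2, M, h1, h2, h3, fun i hi => h4 i.succ (by simpa using hi)⟩
  · rintro ⟨a, b, M, h1, h2, h3, h4⟩
    refine ⟨⟨M, h1, h2, h3⟩, fun i => ?_⟩
    refine Fin.cases ?_ ?_ i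
    · intro _; exact ⟨a, b⟩
    · intro i hi; exact h4 i (by simpa using hi)

lemma wt_cons {d : ℕ} (Z : Fin (d + 1) → ℕ) :
    wtW Z = (∑ i, Z i) + wtW (fun i : Fin d => Z i.succ) := by
  simp only [wtW, Fin.sum_univ_succ, Fin.val_succ]
  simp only [Fin.val_zero, zero_add, one_mul, add_assoc, ← Finset.sum_add_distrib]
  congr 1
  apply Finset.sum_congr rfl
  intro i _
  ring

lemma sum_le_wt {d : ℕ} (Z : Fin d → ℕ) : ∑ i, Z i ≤ wtW Z := by
  apply Finset.sum_le_sum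
  intro i _
  nlinarith [Nat.zero_le (i : ℕ), Nat.zero_le (Z i), Nat.zero_le ((i : ℕ) * Z i)]

/-- The exchange step. -/
lemma exchange {p f : ℕ} (hp : p.Prime) (hf : 0 < f) {d N n : ℕ} (Z : Fin (d + 1) → ℕ)
    (hZ : Z ∈ Wset p (p ^ f) (d + 1) N) (hlt : N < p ^ (n + 1)) (j : Fin (d + 1)) (hj : j ≠ 0)
    (hjn : 0 < dg p (Z j) n) :
    ∃ Y ∈ Wset p (p ^ f) (d + 1) N, Z 0 < Y 0 ∧ wtW Y < wtW Z := by
  have hp1 := hp.one_lt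
  have hp0 : 0 < p := by omega
  obtain ⟨⟨hs, hdig⟩, hev⟩ := hZ
  change ∀ k, (∑ i, dg p (Z i) k) = dg p N k at hdig
  have hjpos : 0 < (j : ℕ) := Fin.pos_iff_ne_zero.mpr hj
  have h0 := hev 0 (by have := j.2; simp; omega)
  have hpair : ∀ k, dg p (Z 0) k + dg p (Z j) k < p := by
    intro k
    have h1 : ∑ i ∈ ({0, j} : Finset (Fin (d+1))), dg p (Z i) k ≤ ∑ i, dg p (Z i) k :=
      Finset.sum_le_sum_of_subset (Finset.subset_univ _)
    rw [Finset.sum_pair hj.symm, hdig] at h1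
    exact lt_of_le_of_lt h1 (dg_lt hp1 _ _)
  have hle : ∀ i, Z i ≤ N := by
    intro i
    rw [← hs]
    exact Finset.single_le_sum (fun _ _ => Nat.zero_le _) (Finset.mem_univ i)
  obtain ⟨c, c1, c2, c3, c4, c5⟩ := exists_sub p f hp hf n (Z 0) h0.1 h0.2
    (lt_of_le_of_lt (hle 0) hlt) (by have := hpair n; omega)
  have hcS : ∑ j ∈ Finset.range (n + 1), c j * p ^ j = ∑ j ∈ Finset.range n, c j * p ^ j := by
    rw [Finset.sum_range_succ, c2 n le_rfl]; simp
  have hdS := dg_val hp1 c (fun k => lt_of_le_of_lt (c1 k) (dg_lt hp1 _ _)) n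
  set S := ∑ j ∈ Finset.range n, c j * p ^ j with hS
  have hdS' : ∀ k, dg p S k = c k := by
    intro k
    rw [hdS]
    split_ifs with h
    · rfl
    · exact (c2 k (by omega)).symm
  obtain ⟨R, hR1, hR2⟩ := dg_split hp1 (Z 0) (n+1) (lt_of_le_of_lt (hle 0) hlt) c c1
  rw [hcS] at hR1
  simp only [← hdS'] at hR2
  have hdP : ∀ k, dg p (p ^ n) k = if k = n then 1 else 0 := by
    intro k
    have := dg_mul_pow hp1 1 n k hp1
    simpa using this
  obtain ⟨T, hT1, hT2⟩ := dg_split hp1 (Z j) (n+1) (lt_of_le_of_lt (hle j) hlt)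
    (fun k => if k = n then 1 else 0) (by
      intro k
      split_ifs with h
      · subst h; exact hjn
      · omega)
  have hPs : ∑ x ∈ Finset.range (n+1), (if x = n then 1 else 0) * p ^ x = p ^ n := by
    simp
  rw [hPs] at hT1
  simp only [← hdP] at hT2
  have dRP : ∀ k, dg p (R + p ^ n) k = dg p R k + dg p (p ^ n) k := by
    intro k
    apply dg_add hp1
    intro k
    have := hpair k
    have := hR2 k
    have := hT2 k
    omega
  have dTS : ∀ k, dg p (T + S) k = dg p T k + dg p S k := by
    intro k
    apply dg_add hp1
    intro k
    have := hpair k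
    have := hR2 k
    have := hT2 k
    omega
  let Y : Fin (d+1) → ℕ := fun i => if i = 0 then R + p ^ n else if i = j then T + S else Z i
  have hY0 : Y 0 = R + p ^ n := by simp [Y]
  have hYj : Y j = T + S := by simp [Y, hj]
  have hYo : ∀ i, i ≠ 0 → i ≠ j → Y i = Z i := by
    intro i h1 h2; simp [Y, h1, h2]
  have hrel : ∀ i, Y i + (if i = 0 then S else 0) + (if i = j then p ^ n else 0)
      = Z i + (if i = 0 then p ^ n else 0) + (if i = j then S else 0) := by
    intro i
    by_cases hi0 : i = 0
    · subst hi0; rw [hY0]; simp [hj.symm]; omega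
    by_cases hij : i = j
    · subst hij; rw [hYj]; simp [hi0]; omega
    rw [hYo i hi0 hij]; simp [hi0, hij]
  have hreld : ∀ k i, dg p (Y i) k + (if i = 0 then dg p S k else 0) + (if i = j then dg p (p ^ n) k else 0)
      = dg p (Z i) k + (if i = 0 then dg p (p ^ n) k else 0) + (if i = j then dg p S k else 0) := by
    intro k i
    have h1 := hR2 k
    have h2 := hT2 k
    by_cases hi0 : i = 0
    · subst hi0; rw [hY0, dRP]; simp [hj.symm]; omega
    by_cases hij : i = j
    · subst hij; rw [hYj, dTS]; simp [hi0]; omega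
    rw [hYo i hi0 hij]; simp [hi0, hij]
  refine ⟨Y, ⟨⟨?_, ?_⟩, ?_⟩, ?_, ?_⟩
  · have := Finset.sum_congr (rfl : (Finset.univ : Finset (Fin (d+1))) = Finset.univ) (fun i _ => hrel i)
    simp only [Finset.sum_add_distrib, Finset.sum_ite_eq', Finset.mem_univ, if_true] at this
    omega
  · intro k
    have := Finset.sum_congr (rfl : (Finset.univ : Finset (Fin (d+1))) = Finset.univ) (fun i _ => hreld k i)
    simp only [Finset.sum_add_distrib, Finset.sum_ite_eq', Finset.mem_univ, if_true] at this
    have h2 := hdig k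
    change ∑ i, dg p (Y i) k = dg p N k
    omega
  · intro i hi
    have hpn : 0 < p ^ n := by positivity
    by_cases hi0 : i = 0
    · subst hi0
      rw [hY0]
      refine ⟨by omega, ?_⟩
      have e := h0.2
      rw [hR1, ← Nat.modEq_zero_iff_dvd] at e
      rw [← Nat.modEq_zero_iff_dvd, add_comm]
      exact (c5.symm.add_right R).trans e
    by_cases hij : i = j
    · subst hij
      rw [hYj]
      refine ⟨by omega, ?_⟩
      have e := (hev i hi).2
      rw [hT1, ← Nat.modEq_zero_iff_dvd] at e
      rw [← Nat.modEq_zero_iff_dvd, add_comm]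
      exact (c5.add_right T).trans e
    rw [hYo i hi0 hij]
    exact hev i hi
  · rw [hY0]; omega
  · have := Finset.sum_congr (rfl : (Finset.univ : Finset (Fin (d+1))) = Finset.univ)
      (fun i _ => congrArg (fun x => ((i : ℕ) + 1) * x) (hrel i))
    simp only [mul_add, mul_ite, mul_zero, Finset.sum_add_distrib, Finset.sum_ite_eq',
      Finset.mem_univ, if_true] at this
    have e1 : ∑ i : Fin (d+1), ((i : ℕ) + 1) * Y i = wtW Y := rfl
    have e2 : ∑ i : Fin (d+1), ((i : ℕ) + 1) * Z i = wtW Z := rfl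
    have h3 : (j : ℕ) * S < (j : ℕ) * p ^ n := Nat.mul_lt_mul_of_pos_left c4 hjpos
    simp only [add_mul, one_mul, Fin.val_zero, Finset.sum_add_distrib] at this e1 e2
    simp at this
    omega

lemma lex_cons {d : ℕ} (Y Z : Fin (d + 1) → ℕ) (h : LexLE Y Z) (h0 : Y 0 = Z 0) :
    LexLE (fun i : Fin d => Y i.succ) (fun i => Z i.succ) := by
  rcases h with h | ⟨i, h1, h2⟩
  · left; rw [h]
  · right
    induction i using Fin.cases with
    | zero => omega
    | succ i => exact ⟨i, fun j hj => h1 j.succ (by simpa using hj), h2⟩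

lemma lex_zero {d : ℕ} (Y Z : Fin (d + 1) → ℕ) (h : LexLE Y Z) : Y 0 ≤ Z 0 := by
  rcases h with h | ⟨i, h1, h2⟩
  · rw [h]
  · induction i using Fin.cases with
    | zero => omega
    | succ i => exact (h1 0 (Fin.succ_pos i)).le

lemma part_one {p f : ℕ} (hp : p.Prime) (hf : 0 < f) {d N : ℕ} (hN : 0 < N) (Z : Fin (d + 1) → ℕ)
    (hZ : Modest p (p ^ f) N Z ∨ Optimal p (p ^ f) N Z) :
    N / p ^ Nat.log p N % p * p ^ Nat.log p N ≤ Z 0 ∧ N < 2 * Z 0 := by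
  have hp1 := hp.one_lt
  have hp0 : 0 < p := by omega
  set n := Nat.log p N with hn
  have hlt : N < p ^ (n + 1) := Nat.lt_pow_succ_log_self hp1 N
  have hge : p ^ n ≤ N := Nat.pow_log_le_self p (by omega)
  have hmem : Z ∈ Wset p (p ^ f) (d + 1) N := by
    rcases hZ with h | h <;> exact h.1
  have hzero : ∀ j : Fin (d+1), j ≠ 0 → dg p (Z j) n = 0 := by
    intro j hj
    by_contra hne
    obtain ⟨Y, hY, h1, h2⟩ := exchange hp hf Z hmem hlt j hj (by omega)
    rcases hZ with h | h
    · have := lex_zero _ _ (h.2 Y hY); omega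
    · have := h.2 Y hY; omega
  have hd : dg p (Z 0) n = dg p N n := by
    have := hmem.1.2 n
    change ∑ i, dg p (Z i) n = dg p N n at this
    rw [← this, Finset.sum_eq_single 0]
    · intro b _ hb; exact hzero b hb
    · simp
  have hA : dg p N n * p ^ n ≤ Z 0 := by
    rw [← hd]
    calc Z 0 / p ^ n % p * p ^ n ≤ Z 0 / p ^ n * p ^ n :=
          Nat.mul_le_mul_right _ (Nat.mod_le _ _)
      _ ≤ Z 0 := Nat.div_mul_le_self _ _
  refine ⟨hA, ?_⟩
  have hdn : dg p N n = N / p ^ n := by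
    apply Nat.mod_eq_of_lt
    rw [Nat.div_lt_iff_lt_mul (by positivity), ← pow_succ']
    exact hlt
  rw [hdn] at hA
  have h1 : 1 ≤ N / p ^ n := (Nat.one_le_div_iff (by positivity)).mpr hge
  have h2 := Nat.div_add_mod N (p ^ n)
  have h3 := Nat.mod_lt N (show 0 < p ^ n by positivity)
  nlinarith

lemma part_two {p f : ℕ} (hp : p.Prime) (hf : 0 < f) (d : ℕ) : ∀ (N : ℕ), 0 < N →
    ∀ Z : Fin (d + 1) → ℕ, (Modest p (p ^ f) N Z ∨ Optimal p (p ^ f) N Z) →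
    wtW Z < 2 * N := by
  have hp1 := hp.one_lt
  induction d with
  | zero =>
    intro N hN Z hZ
    have hmem : Z ∈ Wset p (p ^ f) 1 N := by
      rcases hZ with h | h <;> exact h.1
    have hs : ∑ i, Z i = N := hmem.1.1
    simp [wtW] at hs ⊢
    omega
  | succ d ih =>
    intro N hN Z hZ
    have hmem : Z ∈ Wset p (p ^ f) (d + 2) N := by
      rcases hZ with h | h <;> exact h.1
    have hs : ∑ i, Z i = N := hmem.1.1
    obtain ⟨hz, hze, M, hM, hMd, hT⟩ := (wset_cons hp1 Z N).mp hmem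
    have h1 := (part_one hp hf hN Z hZ).2
    have hcons : ∀ Y ∈ Wset p (p ^ f) (d + 1) M,
        (Fin.cons (Z 0) Y : Fin (d + 2) → ℕ) ∈ Wset p (p ^ f) (d + 2) N := by
      intro Y hY
      rw [wset_cons hp1]
      refine ⟨by simpa using hz, by simpa using hze, M, by simpa using hM, by simpa using hMd, ?_⟩
      simpa using hY
    rw [wt_cons, hs]
    rcases Nat.eq_zero_or_pos M with h0 | h0
    · have hsum : ∑ i : Fin (d+1), Z i.succ = M := hT.1.1
      rw [h0, Finset.sum_eq_zero_iff] at hsum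
      have : wtW (fun i : Fin (d+1) => Z i.succ) = 0 := by
        apply Finset.sum_eq_zero
        intro i hi
        simp [hsum i hi]
      omega
    · have := ih M h0 (fun i => Z i.succ) (by
        rcases hZ with h | h
        · left
          refine ⟨hT, fun Y hY => ?_⟩
          have := lex_cons _ _ (h.2 _ (hcons Y hY)) (by simp)
          simpa using this
        · right
          refine ⟨hT, fun Y hY => ?_⟩
          have h2 := h.2 _ (hcons Y hY)
          rw [wt_cons Z, wt_cons (Fin.cons _ _), hs, (hcons Y hY).1.1] at h2
          simpa using h2)
      omega

lemma part_three {p f : ℕ} (hp : p.Prime) (hf : 0 < f) {d N : ℕ} (Z : Fin (d + 2) → ℕ)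
    (hZ : Modest p (p ^ f) N Z ∨ Optimal p (p ^ f) N Z) :
    Wset p (p ^ f) (d + 2) (N - Z 0) = ∅ := by
  have hp1 := hp.one_lt
  have hmem : Z ∈ Wset p (p ^ f) (d + 2) N := by
    rcases hZ with h | h <;> exact h.1
  have hs : ∑ i, Z i = N := hmem.1.1
  obtain ⟨hz, hze, M, hM, hMd, hT⟩ := (wset_cons hp1 Z N).mp hmem
  have hNM : N - Z 0 = M := by omega
  rw [hNM]
  by_contra hne
  obtain ⟨Y0, hY0⟩ := Set.nonempty_iff_ne_empty.mpr hne
  -- choose an optimal element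
  obtain ⟨Y, hY, hmin⟩ : ∃ Y ∈ Wset p (p ^ f) (d + 2) M,
      ∀ X ∈ Wset p (p ^ f) (d + 2) M, wtW Y ≤ wtW X := by
    obtain ⟨Y, hY, hm⟩ := (measure (fun X : Fin (d+2) → ℕ => wtW X)).wf.has_min _ ⟨Y0, hY0⟩
    exact ⟨Y, hY, fun X hX => not_lt.mp (hm X hX)⟩
  obtain ⟨hy, hye, M', hM', hMd', hT'⟩ := (wset_cons hp1 Y M).mp hY
  have hlt := part_two hp hf (d + 1) M (by omega) Y (Or.inr ⟨hY, hmin⟩)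
  have hdadd : ∀ k, dg p (Z 0 + Y 0) k = dg p (Z 0) k + dg p (Y 0) k := by
    intro k
    apply dg_add hp1
    intro k
    have := hMd k
    have := hMd' k
    have := dg_lt hp1 N k
    omega
  have hnew : (Fin.cons (Z 0 + Y 0) (fun i : Fin (d+1) => Y i.succ) : Fin (d + 2) → ℕ) ∈
      Wset p (p ^ f) (d + 2) N := by
    rw [wset_cons hp1]
    refine ⟨by simp; omega, by simpa using dvd_add hze hye, M', by simp; omega, ?_, ?_⟩
    · intro k
      have := hMd k
      have := hMd' k
      have := hdadd k
      simp only [Fin.cons_zero]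
      omega
    · simpa using hT'
  rcases hZ with h | h
  · have := lex_zero _ _ (h.2 _ hnew)
    simp at this
    omega
  · have h2 := h.2 _ hnew
    rw [wt_cons Z, wt_cons (Fin.cons _ _), hs, hnew.1.1] at h2
    simp only [Fin.cons_succ] at h2
    have h3 := sum_le_wt (fun i : Fin (d+1) => Z i.succ)
    have h4 : ∑ i : Fin (d+1), Z i.succ = M := hT.1.1
    rw [wt_cons Y, hY.1.1] at hlt
    omega

/-- bounds on the first entry and the weight of a modest or optimal
composition, where `a_n p^n` is the leading term of the base-`p` expansion of `N`. -/
theorem modest_optimal_bounds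
    (p f : ℕ) (hp : p.Prime) (hf : 0 < f) (N d : ℕ) (hN : 0 < N) (hd : 0 < d)
    (Z : Fin d → ℕ) (hZ : Modest p (p ^ f) N Z ∨ Optimal p (p ^ f) N Z) :
    (N / p ^ Nat.log p N % p * p ^ Nat.log p N ≤ Z ⟨0, hd⟩ ∧ N < 2 * Z ⟨0, hd⟩) ∧
    (N ≤ wtW Z ∧ wtW Z < 2 * N) ∧
    (2 ≤ d → Wset p (p ^ f) d (N - Z ⟨0, hd⟩) = ∅) := by
  obtain ⟨e, rfl⟩ : ∃ e, d = e + 1 := ⟨d - 1, by omega⟩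
  have hs : ∑ i, Z i = N := by
    rcases hZ with h | h <;> exact h.1.1.1
  refine ⟨part_one hp hf hN Z hZ, ⟨?_, part_two hp hf e N hN Z hZ⟩, ?_⟩
  · have := sum_le_wt Z
    omega
  · intro h2
    obtain ⟨e', rfl⟩ : ∃ e', e = e' + 1 := ⟨e - 1, by omega⟩
    exact part_three hp hf Z hZ
end
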